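/- (Characterization Theorem) Let Λ be an expressively complete set of monotone predicate liftings for a set functor T, and assume that the one-step second-order language SO¹_Λ(A) admits uniform translations (for every finite set A of variables). Then μML_Λ is the bisimulation-invariant fragment of MSO_Λ: a formula of MSO_Λ is invariant for behavioral equivalence if and only if it is equivalent, over all pointed T-models, to a formula of μML_Λ. -/

import Mathlib

open scoped Classical

/-- A set functor: an endofunctor on the category of sets (types in `Type`). -/
structure SetFunctor where
  obj : Type → Type
  map : {X Y : Type} → (X → Y) → obj X → obj Y
  map_id : ∀ {X : Type} (x : obj X), map id x = x
  map_comp : ∀ {X Y Z : Type} (f : X → Y) (g : Y → Z) (x : obj X),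
    map (g ∘ f) x = map g (map f x)

/-- An `n`-place predicate lifting for `T`: a natural transformation `𝒬(-)ⁿ → 𝒬 ∘ T`. -/
structure PredLifting (T : SetFunctor) (n : ℕ) where
  app : (X : Type) → (Fin n → Set X) → Set (T.obj X)
  natural : ∀ {X Y : Type} (f : X → Y) (V : Fin n → Set Y),
    app X (fun i => f ⁻¹' V i) = T.map f ⁻¹' app Y V

/-- Monotonicity of a predicate lifting. -/
def PredLifting.Mono {T : SetFunctor} {n : ℕ} (l : PredLifting T n) : Prop :=
  ∀ (X : Type) (V V' : Fin n → Set X), (∀ i, V i ⊆ V' i) → l.app X V ⊆ l.app X V'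

/-- A set `Λ` of monotone predicate liftings for `T`, presented as an indexed family. -/
structure LiftingFamily (T : SetFunctor) where
  ι : Type
  ar : ι → ℕ
  lf : (i : ι) → PredLifting T (ar i)
  mono : ∀ i, (lf i).Mono

/-- A generalized predicate lifting over a set `A` of variables. -/
structure GenLifting (T : SetFunctor) (A : Type) where
  app : (X : Type) → (A → Set X) → Set (T.obj X)

/-- Monotonicity for generalized predicate liftings. -/
def GenLifting.Mono {T : SetFunctor} {A : Type} (φ : GenLifting T A) : Prop :=
  ∀ (X : Type) (V V' : A → Set X), (∀ a : A, V a ⊆ V' a) → φ.app X V ⊆ φ.app X V'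

/-- Naturality for generalized predicate liftings. -/
def GenLifting.Natural {T : SetFunctor} {A : Type} (φ : GenLifting T A) : Prop :=
  ∀ (X Y : Type) (f : X → Y) (V : A → Set Y),
    φ.app X (fun a => f ⁻¹' V a) = T.map f ⁻¹' φ.app Y V

/-- Updating a valuation at one variable. -/
noncomputable def updW {W X : Type} (V : W → Set X) (w : W) (Z : Set X) : W → Set X :=
  fun w' => if w' = w then Z else V w'

/-- Formulas of the one-step second-order language over variables `W`. -/
inductive SOForm {T : SetFunctor} (F : LiftingFamily T) (W : Type) : Type
  | subset (a b : W)
  | lift (i : F.ι) (v : Fin (F.ar i) → W)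
  | neg (φ : SOForm F W)
  | or (φ ψ : SOForm F W)
  | ex (w : W) (φ : SOForm F W)

/-- One-step satisfaction of second-order one-step formulas. -/
def SOForm.sat {T : SetFunctor} {F : LiftingFamily T} {W : Type} (X : Type) (α : T.obj X) :
    SOForm F W → (W → Set X) → Prop
  | .subset a b, V => V a ⊆ V b
  | .lift i v, V => α ∈ (F.lf i).app X (fun k => V (v k))
  | .neg φ, V => ¬ φ.sat X α V
  | .or φ ψ, V => φ.sat X α V ∨ ψ.sat X α V
  | .ex w φ, V => ∃ Z : Set X, φ.sat X α (updW V w Z)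

/-- Free variables of a one-step second-order formula. -/
def SOForm.fv {T : SetFunctor} {F : LiftingFamily T} {W : Type} : SOForm F W → Set W
  | .subset a b => {a, b}
  | .lift _ v => Set.range v
  | .neg φ => φ.fv
  | .or φ ψ => φ.fv ∪ ψ.fv
  | .ex w φ => φ.fv \ {w}

/-- Quantifier depth of a one-step second-order formula. -/
def SOForm.qd {T : SetFunctor} {F : LiftingFamily T} {W : Type} : SOForm F W → ℕ
  | .subset _ _ => 0
  | .lift _ _ => 0
  | .neg φ => φ.qd
  | .or φ ψ => max φ.qd ψ.qd
  | .ex _ φ => φ.qd + 1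

/-- A one-step second-order sentence over `A`: a formula over `A ⊕ ℕ` all of whose
free variables come from `A`. -/
def IsSentence {T : SetFunctor} {F : LiftingFamily T} {A : Type}
    (φ : SOForm F (A ⊕ ℕ)) : Prop :=
  ∀ w ∈ φ.fv, ∃ a : A, w = Sum.inl a

/-- Satisfaction of a sentence over `A` at a one-step model `(X, α, V)`. -/
def SOForm.sat0 {T : SetFunctor} {F : LiftingFamily T} {A : Type} (X : Type) (α : T.obj X)
    (φ : SOForm F (A ⊕ ℕ)) (V : A → Set X) : Prop :=
  φ.sat X α (Sum.elim V (fun _ => (∅ : Set X)))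

/-- A sentence is monotone if its induced generalized predicate lifting is monotone. -/
def MonotoneSent {T : SetFunctor} {F : LiftingFamily T} {A : Type}
    (φ : SOForm F (A ⊕ ℕ)) : Prop :=
  ∀ (X : Type) (α : T.obj X) (V V' : A → Set X),
    (∀ a : A, V a ⊆ V' a) → φ.sat0 X α V → φ.sat0 X α V'

/-- A uniform construction for `T`. -/
structure UniformConstruction (T : SetFunctor) where
  star : (X : Type) → T.obj X → Type
  el : (X : Type) → (α : T.obj X) → T.obj (star X α)
  h : (X : Type) → (α : T.obj X) → star X α → X
  spec : ∀ (X : Type) (α : T.obj X), T.map (h X α) (el X α) = α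

/-- `SO¹_Λ` admits uniform translations: for every `k` there are a uniform construction
and an assignment of monotone (natural) predicate liftings `φ*` to monotone sentences
`φ` of quantifier depth at most `k` such that `(X,α,V) ⊨ φ*` iff
`(X_*, α_*, V_[h_α]) ⊨ φ`. -/
def AdmitsUniformTranslations {T : SetFunctor} (F : LiftingFamily T) : Prop :=
  ∀ k : ℕ, ∃ U : UniformConstruction T,
    ∀ (A : Type) (φ : SOForm F (A ⊕ ℕ)), IsSentence φ → MonotoneSent φ → φ.qd ≤ k →
      ∃ g : GenLifting T A, g.Natural ∧ g.Mono ∧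
        ∀ (X : Type) (α : T.obj X) (V : A → Set X),
          α ∈ g.app X V ↔ φ.sat0 (U.star X α) (U.el X α) (fun a => U.h X α ⁻¹' V a)

/-- Positive lattice terms over variables `A`. -/
inductive LatTerm (A : Type) : Type
  | var (a : A)
  | and (s t : LatTerm A)
  | or (s t : LatTerm A)

/-- Semantics of lattice terms. -/
def LatTerm.sem {A X : Type} : LatTerm A → (A → Set X) → Set X
  | .var a, V => V a
  | .and s t, V => s.sem V ∩ t.sem V
  | .or s t, V => s.sem V ∪ t.sem V

/-- The modal one-step language `ML¹_Λ(A)`. -/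
inductive ML1 {T : SetFunctor} (F : LiftingFamily T) (A : Type) : Type
  | bot
  | top
  | lift (i : F.ι) (ψ : Fin (F.ar i) → LatTerm A)
  | or (φ ψ : ML1 F A)
  | and (φ ψ : ML1 F A)

/-- One-step satisfaction of modal one-step formulas. -/
def ML1.sat {T : SetFunctor} {F : LiftingFamily T} {A : Type} (X : Type) (α : T.obj X)
    (V : A → Set X) : ML1 F A → Prop
  | .bot => False
  | .top => True
  | .lift i ψ => α ∈ (F.lf i).app X (fun k => (ψ k).sem V)
  | .or φ ψ => φ.sat X α V ∨ ψ.sat X α V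
  | .and φ ψ => φ.sat X α V ∧ ψ.sat X α V

/-- `Λ` is expressively complete: every monotone natural predicate lifting over a finite
variable set is expressible by a modal one-step formula over `Λ`. -/
def ExpressivelyComplete {T : SetFunctor} (F : LiftingFamily T) : Prop :=
  ∀ (A : Type), Finite A → ∀ g : GenLifting T A, g.Natural → g.Mono →
    ∃ φ : ML1 F A, ∀ (X : Type) (α : T.obj X) (V : A → Set X),
      φ.sat X α V ↔ α ∈ g.app X V

/-- A `T`-model. -/
structure TModel (T : SetFunctor) where
  S : Type
  σ : S → T.obj S
  V : ℕ → Set S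

/-- `T`-model homomorphisms. -/
def IsHom {T : SetFunctor} (M N : TModel T) (f : M.S → N.S) : Prop :=
  (∀ (p : ℕ) (x : M.S), x ∈ M.V p ↔ f x ∈ N.V p) ∧
  (∀ x : M.S, N.σ (f x) = T.map f (M.σ x))

/-- Behavioral equivalence of pointed `T`-models. -/
def BehEq {T : SetFunctor} (M : TModel T) (s : M.S) (M' : TModel T) (s' : M'.S) : Prop :=
  ∃ (N : TModel T) (f : M.S → N.S) (g : M'.S → N.S),
    IsHom M N f ∧ IsHom M' N g ∧ f s = g s'

/-- Formulas of coalgebraic monadic second-order logic `MSO_Λ`. -/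
inductive MSOForm {T : SetFunctor} (F : LiftingFamily T) : Type
  | bot
  | sr (p : ℕ)
  | subset (p q : ℕ)
  | lift (i : F.ι) (p : ℕ) (q : Fin (F.ar i) → ℕ)
  | or (φ ψ : MSOForm F)
  | neg (φ : MSOForm F)
  | ex (p : ℕ) (φ : MSOForm F)

/-- Satisfaction of `MSO_Λ`-formulas in a pointed `T`-model. -/
def MSOForm.sat {T : SetFunctor} {F : LiftingFamily T} {S : Type} (σ : S → T.obj S) :
    MSOForm F → (ℕ → Set S) → S → Prop
  | .bot, _, _ => False
  | .sr p, V, u => V p = {u}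
  | .subset p q, V, _ => V p ⊆ V q
  | .lift i p qs, V, _ => ∀ v ∈ V p, σ v ∈ (F.lf i).app S (fun k => V (qs k))
  | .or φ ψ, V, u => φ.sat σ V u ∨ ψ.sat σ V u
  | .neg φ, V, u => ¬ φ.sat σ V u
  | .ex p φ, V, u => ∃ Z : Set S, φ.sat σ (updW V p Z) u

/-- Bisimulation invariance (invariance for behavioral equivalence) of an
`MSO_Λ`-formula. -/
def BisimInv {T : SetFunctor} {F : LiftingFamily T} (φ : MSOForm F) : Prop :=
  ∀ (M : TModel T) (s : M.S) (M' : TModel T) (s' : M'.S),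
    BehEq M s M' s' → (φ.sat M.σ M.V s ↔ φ.sat M'.σ M'.V s')

/-- Formulas of the coalgebraic μ-calculus `μML_Λ` (in negation normal form). -/
inductive MuForm {T : SetFunctor} (F : LiftingFamily T) : Type
  | var (p : ℕ)
  | nvar (p : ℕ)
  | bot
  | top
  | lift (i : F.ι) (arg : Fin (F.ar i) → MuForm F)
  | or (φ ψ : MuForm F)
  | and (φ ψ : MuForm F)
  | mu (p : ℕ) (φ : MuForm F)
  | nu (p : ℕ) (φ : MuForm F)

/-- `φ.PosIn p`: no free occurrence of `p` is negated in `φ`. -/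
def MuForm.PosIn {T : SetFunctor} {F : LiftingFamily T} (p : ℕ) : MuForm F → Prop
  | .var _ => True
  | .nvar q => q ≠ p
  | .bot => True
  | .top => True
  | .lift _ arg => ∀ k, (arg k).PosIn p
  | .or φ ψ => φ.PosIn p ∧ ψ.PosIn p
  | .and φ ψ => φ.PosIn p ∧ ψ.PosIn p
  | .mu q φ => q = p ∨ φ.PosIn p
  | .nu q φ => q = p ∨ φ.PosIn p

/-- Well-formedness of μ-calculus formulas. -/
def MuForm.WF {T : SetFunctor} {F : LiftingFamily T} : MuForm F → Prop
  | .var _ => True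
  | .nvar _ => True
  | .bot => True
  | .top => True
  | .lift _ arg => ∀ k, (arg k).WF
  | .or φ ψ => φ.WF ∧ ψ.WF
  | .and φ ψ => φ.WF ∧ ψ.WF
  | .mu p φ => φ.PosIn p ∧ φ.WF
  | .nu p φ => φ.PosIn p ∧ φ.WF

/-- Semantics of `μML_Λ`: truth sets, with `μ`/`ν` as least/greatest fixpoints. -/
noncomputable def MuForm.sem {T : SetFunctor} {F : LiftingFamily T} {S : Type}
    (σ : S → T.obj S) : MuForm F → (ℕ → Set S) → Set S
  | .var p, V => V p
  | .nvar p, V => (V p)ᶜ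
  | .bot, _ => ∅
  | .top, _ => Set.univ
  | .lift i arg, V => {s : S | σ s ∈ (F.lf i).app S (fun k => (arg k).sem σ V)}
  | .or φ ψ, V => φ.sem σ V ∪ ψ.sem σ V
  | .and φ ψ, V => φ.sem σ V ∩ ψ.sem σ V
  | .mu p φ, V => ⋂₀ {Z : Set S | φ.sem σ (updW V p Z) ⊆ Z}
  | .nu p φ, V => ⋃₀ {Z : Set S | Z ⊆ φ.sem σ (updW V p Z)}

/-! ### Parity sequences -/

/-- The largest value occurring infinitely often exists and is even. -/
def Par (a : ℕ → ℕ) : Prop :=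
  ∃ m, Even m ∧ (∀ N, ∃ i ≥ N, a i = m) ∧ ∃ N, ∀ i ≥ N, a i ≤ m

theorem Par.of_shift {a : ℕ → ℕ} (k : ℕ) (h : Par fun i => a (i + k)) : Par a := by
  obtain ⟨m, hm, h1, N, h2⟩ := h
  refine ⟨m, hm, fun M => ?_, N + k, fun i hi => ?_⟩
  · obtain ⟨i, hi, e⟩ := h1 M
    exact ⟨i + k, by omega, e⟩
  · have := h2 (i - k) (by omega)
    simp only at this
    rwa [Nat.sub_add_cancel (by omega)] at this

theorem not_par_and_par_succ {a : ℕ → ℕ} (h : Par a) (h' : Par fun i => a i + 1) : False := by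
  obtain ⟨m, hm, h1, N, h2⟩ := h
  obtain ⟨m', hm', h1', N', h2'⟩ := h'
  obtain ⟨i, hi, e⟩ := h1 N'
  obtain ⟨j, hj, e'⟩ := h1' N
  have h3 := h2' i hi
  have h4 := h2 j hj
  simp only at h3 e'
  have : m' = m + 1 := by omega
  subst this
  rcases hm with ⟨c, hc⟩
  rcases hm' with ⟨d, hd⟩
  omega

/-! ### Fixpoints of set operators -/

/-- Greatest (`ν`) or least (`¬ ν`) fixpoint, in the style of `MuForm.sem`. -/
def fp {S : Type} (ν : Prop) (G : Set S → Set S) : Set S :=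
  if ν then ⋃₀ {Z | Z ⊆ G Z} else ⋂₀ {Z | G Z ⊆ Z}

theorem fp_congr {S : Type} {ν ν' : Prop} {G G' : Set S → Set S} (hν : ν ↔ ν')
    (h : ∀ Z, G Z = G' Z) : fp ν G = fp ν' G' := by
  obtain rfl : G = G' := funext h
  simp [fp, hν]

theorem fp_mono {S : Type} (ν : Prop) {G G' : Set S → Set S} (h : ∀ Z, G Z ⊆ G' Z) :
    fp ν G ⊆ fp ν G' := by
  unfold fp
  split_ifs
  · exact Set.sUnion_subset_sUnion fun Z hZ => Set.Subset.trans hZ (h Z)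
  · exact Set.sInter_subset_sInter fun Z hZ => Set.Subset.trans (h Z) hZ

theorem fp_compl {S : Type} (ν : Prop) (G : Set S → Set S) :
    (fp ν G)ᶜ = fp (¬ ν) (fun Z => (G Zᶜ)ᶜ) := by
  unfold fp
  by_cases hν : ν
  · simp only [hν, if_true, not_true_eq_false, if_false]
    ext x
    simp only [Set.mem_compl_iff, Set.mem_sUnion, Set.mem_sInter, Set.mem_ofPred_eq, not_exists,
      not_and]
    constructor
    · intro h Z hZ
      by_contra hx
      exact h Zᶜ (by rwa [Set.compl_subset_comm] at hZ) hx
    · intro h Z hZ hx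
      exact h Zᶜ (by rwa [compl_compl, Set.compl_subset_compl]) hx
  · simp only [hν, if_false, not_false_eq_true, if_true]
    ext x
    simp only [Set.mem_compl_iff, Set.mem_sUnion, Set.mem_sInter, Set.mem_ofPred_eq, not_forall]
    constructor
    · rintro ⟨Z, hZ, hx⟩
      exact ⟨Zᶜ, by rwa [compl_compl, Set.compl_subset_compl], hx⟩
    · rintro ⟨Z, hZ, hx⟩
      exact ⟨Zᶜ, by rwa [Set.subset_compl_comm] at hZ, fun h => h hx⟩

theorem fp_fixed {S : Type} (ν : Prop) {G : Set S → Set S}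
    (hG : ∀ Z Z', Z ⊆ Z' → G Z ⊆ G Z') : G (fp ν G) = fp ν G := by
  let g : Set S →o Set S := ⟨G, fun Z Z' h => hG Z Z' h⟩
  unfold fp
  split_ifs
  · exact OrderHom.map_gfp g
  · exact OrderHom.map_lfp g

/-- Inverse images commute with fixpoints of intertwined operators. -/
theorem fp_preimage {N S : Type} (π : N → S) (ν : Prop) {G : Set S → Set S} {H : Set N → Set N}
    (hG : ∀ Z Z', Z ⊆ Z' → G Z ⊆ G Z') (hH : ∀ Z Z', Z ⊆ Z' → H Z ⊆ H Z')
    (h : ∀ Z, π ⁻¹' G Z = H (π ⁻¹' Z)) : π ⁻¹' fp ν G = fp ν H := by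
  have hfix := fp_fixed ν hG
  have hpre : H (π ⁻¹' fp ν G) = π ⁻¹' fp ν G := by rw [← h, hfix]
  have hfixH := fp_fixed ν hH
  apply Set.Subset.antisymm
  · by_cases hν : ν
    · have : π ⁻¹' fp ν G ⊆ ⋃₀ {Z | Z ⊆ H Z} := Set.subset_sUnion_of_mem hpre.ge
      simpa [fp, hν] using this
    · rw [← Set.subset_kernImage_iff]
      have : G (Set.kernImage π (fp ν H)) ⊆ Set.kernImage π (fp ν H) := by
        rw [Set.subset_kernImage_iff, h, ← hfixH]
        refine hH _ _ ?_
        rw [hfixH, ← Set.subset_kernImage_iff]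
      have h2 : ⋂₀ {Z | G Z ⊆ Z} ⊆ Set.kernImage π (fp ν H) := Set.sInter_subset_of_mem this
      simpa [fp, hν] using h2
  · by_cases hν : ν
    · rw [← Set.image_subset_iff]
      have : π '' fp ν H ⊆ G (π '' fp ν H) := by
        rw [Set.image_subset_iff, h]
        conv_lhs => rw [← hfixH]
        exact hH _ _ (Set.subset_preimage_image π _)
      have h2 : π '' fp ν H ⊆ ⋃₀ {Z | Z ⊆ G Z} := Set.subset_sUnion_of_mem this
      simpa [fp, hν] using h2
    · have : ⋂₀ {Z | H Z ⊆ Z} ⊆ π ⁻¹' fp ν G := Set.sInter_subset_of_mem hpre.le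
      simpa [fp, hν] using this

/-- Elements of a least fixpoint can be ranked so that each is generated from elements of
smaller rank. -/
theorem exists_rank {S : Type} {G : Set S → Set S} (hG : ∀ Z Z', Z ⊆ Z' → G Z ⊆ G Z') :
    ∃ rank : S → Ordinal.{0}, ∀ s ∈ fp False G,
      s ∈ G {s' | s' ∈ fp False G ∧ rank s' < rank s} := by
  let g : Set S →o Set S := ⟨G, fun Z Z' h => hG Z Z' h⟩
  have hy : fp False G = g.lfp := by simp [fp]; rfl
  obtain ⟨κ, hκ⟩ := OrdinalApprox.lfp_mem_range_lfpApprox g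
  have hle : ∀ a, OrdinalApprox.lfpApprox g ⊥ a ⊆ g.lfp := fun a =>
    OrdinalApprox.lfpApprox_le_of_mem_fixedPoints g g.map_lfp bot_le a
  rw [hy]
  refine ⟨fun s => sInf {a | s ∈ OrdinalApprox.lfpApprox g ⊥ a}, fun s hs => ?_⟩
  have hne : {a | s ∈ OrdinalApprox.lfpApprox g ⊥ a}.Nonempty := ⟨κ, by rwa [Set.mem_ofPred_eq, hκ]⟩
  have hmem := csInf_mem hne
  set r := sInf {a | s ∈ OrdinalApprox.lfpApprox g ⊥ a} with hr
  simp only [Set.mem_ofPred_eq] at hmem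
  rw [OrdinalApprox.lfpApprox] at hmem
  simp only [bot_sup_eq, Set.iSup_eq_iUnion, Set.mem_iUnion, exists_prop] at hmem
  obtain ⟨b, hb, hsZ⟩ := hmem
  refine hG _ _ (fun s' hs' => ?_) hsZ
  exact ⟨hle b hs', lt_of_le_of_lt (csInf_le' hs') hb⟩

/-! ### Hierarchical fixpoint systems and parity games -/

/-- Pointwise inclusion of families of sets. -/
def FamLe {Q S : Type} (e e' : Q → Set S) : Prop := ∀ q, e q ⊆ e' q

/-- Monotone operators on families of sets. -/
def OpMono {Q S : Type} (Φ : (Q → Set S) → Q → Set S) : Prop :=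
  ∀ e e', FamLe e e' → FamLe (Φ e) (Φ e')

/-- The dual operator. -/
def opDual {Q S : Type} (Φ : (Q → Set S) → Q → Set S) : (Q → Set S) → Q → Set S :=
  fun e q => (Φ (fun q' => (e q')ᶜ) q)ᶜ

theorem OpMono.dual {Q S : Type} {Φ : (Q → Set S) → Q → Set S} (h : OpMono Φ) :
    OpMono (opDual Φ) := fun _ _ he q =>
  Set.compl_subset_compl.2 (h _ _ (fun q' => Set.compl_subset_compl.2 (he q')) q)

/-- Solution of the system `x_q = Φ x q`, where the states `en 0, …, en (k - 1)` are
bound, the state `en (k - 1)` outermost, and the others are read off the environment. -/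
noncomputable def sol {Q S : Type} (ν : ℕ → Prop) (en : ℕ → Q)
    (Φ : (Q → Set S) → Q → Set S) : ℕ → (Q → Set S) → Q → Set S
  | 0, e => e
  | k + 1, e => sol ν en Φ k
      (updW e (en k) (fp (ν k) fun x => Φ (sol ν en Φ k (updW e (en k) x)) (en k)))

/-- An enumeration of the states compatible with their priorities. -/
structure Enum (Q : Type) (Ω : Q → ℕ) where
  n : ℕ
  en : ℕ → Q
  idx : Q → ℕ
  idx_en : ∀ k < n, idx (en k) = k
  en_idx : ∀ q, en (idx q) = q
  idx_lt : ∀ q, idx q < n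
  mono : ∀ q q', idx q ≤ idx q' → Ω q ≤ Ω q'

theorem exists_enum (Q : Type) [Finite Q] [Nonempty Q] (Ω : Q → ℕ) : Nonempty (Enum Q Ω) := by
  obtain ⟨n, ⟨e⟩⟩ := Finite.exists_equiv_fin Q
  let τ := Tuple.sort (Ω ∘ e.symm)
  have hτ : Monotone ((Ω ∘ e.symm) ∘ τ) := Tuple.monotone_sort _
  refine ⟨⟨n, fun k => if h : k < n then e.symm (τ ⟨k, h⟩) else Classical.arbitrary Q,
    fun q => (τ.symm (e q)).1, fun k hk => by simp [hk], fun q => by simp,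
    fun q => (τ.symm (e q)).2, fun q q' h => ?_⟩⟩
  simpa using hτ (show τ.symm (e q) ≤ τ.symm (e q') from h)

theorem updW_self {W X : Type} (V : W → Set X) (w : W) (Z : Set X) : updW V w Z w = Z := by
  simp [updW]

theorem updW_ne {W X : Type} (V : W → Set X) {w w' : W} (Z : Set X) (h : w' ≠ w) :
    updW V w Z w' = V w' := by
  simp [updW, h]

theorem FamLe.updW {Q S : Type} {e e' : Q → Set S} (h : FamLe e e') (q : Q) {Z Z' : Set S}
    (hZ : Z ⊆ Z') : FamLe (updW e q Z) (updW e' q Z') := by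
  intro q'
  by_cases hq : q' = q
  · subst hq
    simpa [updW_self]
  · simpa [updW_ne _ _ hq] using h q'

theorem FamLe.rfl {Q S : Type} {e : Q → Set S} : FamLe e e := fun _ => Set.Subset.rfl

theorem sol_mono {Q S : Type} {ν : ℕ → Prop} {en : ℕ → Q} {Φ : (Q → Set S) → Q → Set S}
    (hΦ : OpMono Φ) (k : ℕ) : OpMono (sol ν en Φ k) := by
  induction k with
  | zero => exact fun _ _ h => h
  | succ k ih =>
    intro e e' h
    exact ih _ _ (h.updW _ (fp_mono _ fun Z => hΦ _ _ (ih _ _ (h.updW _ Set.Subset.rfl)) _))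

theorem sol_of_le {Q S : Type} {Ω : Q → ℕ} (E : Enum Q Ω) {ν : ℕ → Prop}
    {Φ : (Q → Set S) → Q → Set S} {k : ℕ} (hk : k ≤ E.n) (e : Q → Set S) {q : Q}
    (hq : k ≤ E.idx q) : sol ν E.en Φ k e q = e q := by
  induction k generalizing e with
  | zero => rfl
  | succ k ih =>
    rw [sol, ih (by omega) _ (by omega), updW_ne]
    rintro rfl
    rw [E.idx_en k (by omega)] at hq
    omega

theorem sol_congr {Q S : Type} {ν ν' : ℕ → Prop} {en : ℕ → Q} {Φ Φ' : (Q → Set S) → Q → Set S}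
    (hν : ∀ k, ν k ↔ ν' k) (hΦ : ∀ e q, Φ e q = Φ' e q) (k : ℕ) (e : Q → Set S) :
    sol ν en Φ k e = sol ν' en Φ' k e := by
  obtain rfl : Φ = Φ' := by
    funext e q
    exact hΦ e q
  obtain rfl : ν = ν' := by
    funext k
    exact propext (hν k)
  rfl

theorem updW_compl {W X : Type} (V : W → Set X) (w : W) (Z : Set X) :
    (fun q => (updW V w Z q)ᶜ) = updW (fun q => (V q)ᶜ) w Zᶜ := by
  funext q
  by_cases h : q = w
  · subst h
    simp [updW_self]
  · simp [updW_ne _ _ h]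

theorem sol_compl {Q S : Type} (ν : ℕ → Prop) (en : ℕ → Q) (Φ : (Q → Set S) → Q → Set S)
    (k : ℕ) (e : Q → Set S) :
    (fun q => (sol ν en Φ k e q)ᶜ) =
      sol (fun k => ¬ ν k) en (opDual Φ) k (fun q => (e q)ᶜ) := by
  induction k generalizing e with
  | zero => rfl
  | succ k ih =>
    rw [sol, sol, ih, updW_compl, fp_compl]
    congr 2
    refine fp_congr Iff.rfl fun Z => ?_
    rw [opDual, ← compl_compl Z, ← updW_compl, ← ih]
    simp

/-- Inverse images commute with solutions of intertwined systems. -/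
theorem sol_preimage {Q N S : Type} (π : N → S) (ν : ℕ → Prop) (en : ℕ → Q)
    {Φ : (Q → Set S) → Q → Set S} {Ψ : (Q → Set N) → Q → Set N} (hΦ : OpMono Φ) (hΨ : OpMono Ψ)
    (h : ∀ e q, π ⁻¹' Φ e q = Ψ (fun q' => π ⁻¹' e q') q) (k : ℕ) (e : Q → Set S) :
    (fun q => π ⁻¹' sol ν en Φ k e q) = sol ν en Ψ k (fun q => π ⁻¹' e q) := by
  have hupd : ∀ (e : Q → Set S) q Z,
      (fun q' => π ⁻¹' updW e q Z q') = updW (fun q' => π ⁻¹' e q') q (π ⁻¹' Z) := by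
    intro e q Z
    funext q'
    by_cases hq : q' = q
    · subst hq
      simp [updW_self]
    · simp [updW_ne _ _ hq]
  induction k generalizing e with
  | zero => rfl
  | succ k ih =>
    rw [sol, sol, ih, hupd]
    congr 2
    refine fp_preimage π _ (fun Z Z' hZ => ?_) (fun Z Z' hZ => ?_) fun Z => ?_
    · exact hΦ _ _ (sol_mono hΦ k _ _ (FamLe.rfl.updW _ hZ)) _
    · exact hΨ _ _ (sol_mono hΨ k _ _ (FamLe.rfl.updW _ hZ)) _
    · rw [h, ih, hupd]

/-- Positional winning strategies: `D` is a region closed under the strategy `f` whose plays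
satisfy the parity condition. -/
def Wins {Q S : Type} (Φ : (Q → Set S) → Q → Set S) (Ω : Q → ℕ) (q : Q) (s : S) : Prop :=
  ∃ (f : Q → S → Q → Set S) (D : Q → Set S), s ∈ D q ∧
    (∀ q', ∀ s' ∈ D q', s' ∈ Φ (f q' s') q' ∧ FamLe (f q' s') D) ∧
    ∀ (a : ℕ → Q) (b : ℕ → S), a 0 = q → b 0 = s →
      (∀ i, b (i + 1) ∈ f (a i) (b i) (a (i + 1))) → Par fun i => Ω (a i)

theorem eventually_const_of_antitone {r : ℕ → Ordinal.{0}} (h : ∀ i, r (i + 1) ≤ r i) :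
    ∃ N, ∀ i, r (N + i) = r N := by
  obtain ⟨N, hN⟩ := WellFounded.has_min (r := (· < ·)) Ordinal.lt_wf (Set.range r) ⟨_, 0, rfl⟩
  obtain ⟨⟨N, rfl⟩, hN⟩ := hN
  have hanti : Antitone r := antitone_nat_of_succ_le h
  exact ⟨N, fun i => le_antisymm (hanti (by omega)) (not_lt.1 (hN _ ⟨_, rfl⟩))⟩

/-- Positional strategies for solutions of hierarchical systems; play may leave through the
environment. -/
theorem sol_strategy {Q S : Type} {Ω : Q → ℕ} (E : Enum Q Ω) {Φ : (Q → Set S) → Q → Set S}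
    (hΦ : OpMono Φ) (k : ℕ) (hk : k ≤ E.n) (e : Q → Set S) :
    ∃ f : Q → S → Q → Set S,
      (∀ q, E.idx q < k → ∀ s ∈ sol (fun k => Even (Ω (E.en k))) E.en Φ k e q,
        s ∈ Φ (f q s) q ∧ FamLe (f q s) (sol (fun k => Even (Ω (E.en k))) E.en Φ k e)) ∧
      ∀ (a : ℕ → Q) (b : ℕ → S), (∀ i, E.idx (a i) < k) →
        b 0 ∈ sol (fun k => Even (Ω (E.en k))) E.en Φ k e (a 0) →
        (∀ i, b (i + 1) ∈ f (a i) (b i) (a (i + 1))) → Par fun i => Ω (a i) := by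
  induction k generalizing e with
  | zero => exact ⟨fun _ _ => e, fun q hq => absurd hq (by omega),
      fun a b h => absurd (h 0) (by omega)⟩
  | succ k ih =>
    set ν : ℕ → Prop := fun k => Even (Ω (E.en k)) with hν
    set c := E.en k with hc
    have hidx : E.idx c = k := E.idx_en k (by omega)
    have hlt : ∀ q, E.idx q < k + 1 → q ≠ c → E.idx q < k := by
      intro q hq hne
      have : E.idx q ≠ k := fun h => hne (by rw [hc, ← h, E.en_idx])
      omega
    have hmono : ∀ Z Z', Z ⊆ Z' → FamLe (sol ν E.en Φ k (updW e c Z))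
        (sol ν E.en Φ k (updW e c Z')) := fun Z Z' h => sol_mono hΦ k _ _ (FamLe.rfl.updW _ h)
    have hself : ∀ Z, sol ν E.en Φ k (updW e c Z) c = Z := fun Z => by
      rw [sol_of_le E (by omega) _ hidx.ge, updW_self]
    set G : Set S → Set S := fun x => Φ (sol ν E.en Φ k (updW e c x)) c with hG
    have hGm : ∀ Z Z', Z ⊆ Z' → G Z ⊆ G Z' := fun Z Z' h => hΦ _ _ (hmono _ _ h) _
    have hsol : sol ν E.en Φ (k + 1) e = sol ν E.en Φ k (updW e c (fp (ν k) G)) := rfl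
    choose f hf hfp using fun Z : Set S => ih (by omega) (updW e c Z)
    by_cases hev : ν k
    · set y := fp (ν k) G with hy
      have hyfix : G y = y := fp_fixed _ hGm
      have hstep : ∀ q, E.idx q < k + 1 → ∀ s ∈ sol ν E.en Φ (k + 1) e q,
          s ∈ Φ (if q = c then sol ν E.en Φ (k + 1) e else f y q s) q ∧
          FamLe (if q = c then sol ν E.en Φ (k + 1) e else f y q s) (sol ν E.en Φ (k + 1) e) := by
        intro q hq s hs
        rw [hsol] at hs ⊢
        split_ifs with h
        · subst h
          refine ⟨?_, FamLe.rfl⟩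
          rw [hself, ← hyfix] at hs
          exact hs
        · exact hf y q (hlt q hq h) s hs
      refine ⟨fun q s => if q = c then sol ν E.en Φ (k + 1) e else f y q s, hstep, ?_⟩
      intro a b ha hb hab
      have hin : ∀ i, b i ∈ sol ν E.en Φ (k + 1) e (a i) := by
        intro i
        induction i with
        | zero => exact hb
        | succ i ihi => exact (hstep _ (ha i) _ ihi).2 _ (hab i)
      by_cases hinf : ∀ N, ∃ i ≥ N, a i = c
      · refine ⟨Ω c, hev, fun N => ?_, 0, fun i _ => E.mono _ _ ?_⟩
        · obtain ⟨i, hi, h⟩ := hinf N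
          exact ⟨i, hi, congrArg Ω h⟩
        · have := ha i
          omega
      · push Not at hinf
        obtain ⟨N, hN⟩ := hinf
        refine Par.of_shift N (hfp y (fun i => a (i + N)) (fun i => b (i + N))
          (fun i => hlt _ (ha _) (hN _ (by omega))) (hsol ▸ hin _) fun i => ?_)
        have := hab (i + N)
        simp only [if_neg (hN (i + N) (by omega))] at this
        rwa [show i + 1 + N = i + N + 1 by omega]
    · obtain ⟨rank, hrank⟩ := exists_rank hGm
      have hfalse : fp (ν k) G = fp False G := fp_congr (by simp [hev]) fun _ => rfl
      rw [hfalse] at hsol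
      set y := fp False G with hy
      set Y : Ordinal.{0} → Set S := fun β => {s | s ∈ y ∧ rank s < β} with hY
      set R : Ordinal.{0} → Q → Set S := fun β => sol ν E.en Φ k (updW e c (Y β)) with hR
      have hYy : ∀ β, Y β ⊆ y := fun β s hs => hs.1
      have hRle : ∀ β, FamLe (R β) (sol ν E.en Φ (k + 1) e) := fun β => by
        rw [hsol]
        exact hmono _ _ (hYy β)
      have hRc : ∀ β, R β c = Y β := fun β => hself _
      set ρ : Q → S → Ordinal.{0} := fun q s => sInf {β | s ∈ R β q} with hρ
      have hρmem : ∀ q, ∀ s ∈ sol ν E.en Φ (k + 1) e q, s ∈ R (ρ q s) q := by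
        intro q s hs
        refine csInf_mem (s := {β | s ∈ R β q}) ⟨⨆ s, Order.succ (rank s), ?_⟩
        rw [hsol] at hs
        refine hmono _ _ (fun s' hs' => ?_) q hs
        exact ⟨hs', (Order.lt_succ _).trans_le (Ordinal.le_iSup _ s')⟩
      set g : Q → S → Q → Set S := fun q s =>
        if q = c then R (rank s) else f (Y (ρ q s)) q s with hg
      set r : Q → S → Ordinal.{0} := fun q s => if q = c then rank s else ρ q s with hr
      have hstep : ∀ q, E.idx q < k + 1 → ∀ s ∈ sol ν E.en Φ (k + 1) e q,
          s ∈ Φ (g q s) q ∧ FamLe (g q s) (R (r q s)) := by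
        intro q hq s hs
        simp only [hg, hr]
        split_ifs with h
        · subst h
          rw [hsol, hself] at hs
          exact ⟨hrank s hs, FamLe.rfl⟩
        · exact hf (Y (ρ q s)) q (hlt q hq h) s (hρmem q s hs)
      have hdec : ∀ β q s, s ∈ R β q → r q s ≤ β ∧ (q = c → r q s < β) := by
        intro β q s hs
        simp only [hr]
        split_ifs with h
        · subst h
          rw [hRc] at hs
          exact ⟨hs.2.le, fun _ => hs.2⟩
        · exact ⟨csInf_le' hs, fun h' => absurd h' h⟩
      refine ⟨g, fun q hq s hs => ⟨(hstep q hq s hs).1, fun q' =>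
        ((hstep q hq s hs).2 q').trans (hRle _ q')⟩, ?_⟩
      intro a b ha hb hab
      have hin : ∀ i, b i ∈ sol ν E.en Φ (k + 1) e (a i) := by
        intro i
        induction i with
        | zero => exact hb
        | succ i ihi => exact hRle _ _ ((hstep _ (ha i) _ ihi).2 _ (hab i))
      have hnext : ∀ i, b (i + 1) ∈ R (r (a i) (b i)) (a (i + 1)) := fun i =>
        (hstep _ (ha i) _ (hin i)).2 _ (hab i)
      obtain ⟨N, hN⟩ := eventually_const_of_antitone (r := fun i => r (a i) (b i))
        fun i => (hdec _ _ _ (hnext i)).1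
      have hne : ∀ i, a (i + (N + 1)) ≠ c := by
        intro i h
        have h1 := (hdec _ _ _ (hnext (i + N))).2 (by rw [← h]; congr 1)
        have h2 := hN (i + 1)
        have h3 := hN i
        rw [show N + (i + 1) = i + N + 1 by omega] at h2
        rw [show N + i = i + N by omega] at h3
        rw [h2, h3] at h1
        exact lt_irrefl _ h1
      have hρc : ∀ i, ρ (a (i + (N + 1))) (b (i + (N + 1))) = r (a N) (b N) := by
        intro i
        have h2 := hN (i + 1)
        rw [show N + (i + 1) = i + (N + 1) by omega] at h2
        rw [← h2]
        simp only [hr, if_neg (hne i)]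
      refine Par.of_shift (N + 1) (hfp (Y (r (a N) (b N))) (fun i => a (i + (N + 1)))
          (fun i => b (i + (N + 1))) (fun i => hlt _ (ha _) (hne i)) ?_ fun i => ?_)
      · have := hρmem _ _ (hin (0 + (N + 1)))
        rw [hρc] at this
        exact this
      · have := hab (i + (N + 1))
        simp only [hg, if_neg (hne i), hρc] at this
        rwa [show i + 1 + (N + 1) = i + (N + 1) + 1 by omega]

theorem sol_wins {Q S : Type} {Ω : Q → ℕ} (E : Enum Q Ω) {Φ : (Q → Set S) → Q → Set S}
    (hΦ : OpMono Φ) {e : Q → Set S} {q : Q} {s : S}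
    (h : s ∈ sol (fun k => Even (Ω (E.en k))) E.en Φ E.n e q) : Wins Φ Ω q s := by
  obtain ⟨f, hf, hfp⟩ := sol_strategy E hΦ E.n le_rfl e
  refine ⟨f, _, h, fun q' s' hs' => hf q' (E.idx_lt q') s' hs', ?_⟩
  rintro a b rfl rfl hab
  exact hfp a b (fun i => E.idx_lt _) h hab

theorem not_wins_and_dual {Q S : Type} {Ω : Q → ℕ} {Φ : (Q → Set S) → Q → Set S}
    (hΦ : OpMono Φ) {q : Q} {s : S} (h : Wins Φ Ω q s)
    (h' : Wins (opDual Φ) (fun q => Ω q + 1) q s) : False := by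
  obtain ⟨f, D, hD, hf, hp⟩ := h
  obtain ⟨f', D', hD', hf', hp'⟩ := h'
  have hnext : ∀ x : {x : Q × S // x.2 ∈ D x.1 ∧ x.2 ∈ D' x.1},
      ∃ y : {x : Q × S // x.2 ∈ D x.1 ∧ x.2 ∈ D' x.1},
        y.1.2 ∈ f x.1.1 x.1.2 y.1.1 ∧ y.1.2 ∈ f' x.1.1 x.1.2 y.1.1 := by
    rintro ⟨⟨q, s⟩, h1, h2⟩
    obtain ⟨h3, h4⟩ := hf q s h1
    obtain ⟨h5, h6⟩ := hf' q s h2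
    by_contra hcon
    refine h5 (hΦ _ _ (fun q' s' hs' => ?_) q h3)
    intro hs''
    exact hcon ⟨⟨(q', s'), h4 _ hs', h6 _ hs''⟩, hs', hs''⟩
  choose nx hnx hnx' using hnext
  let p : ℕ → {x : Q × S // x.2 ∈ D x.1 ∧ x.2 ∈ D' x.1} :=
    fun i => Nat.rec ⟨(q, s), hD, hD'⟩ (fun _ x => nx x) i
  exact not_par_and_par_succ
    (hp (fun i => (p i).1.1) (fun i => (p i).1.2) rfl rfl fun i => hnx (p i))
    (hp' (fun i => (p i).1.1) (fun i => (p i).1.2) rfl rfl fun i => hnx' (p i))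

theorem mem_sol_or_dual_wins {Q S : Type} {Ω : Q → ℕ} (E : Enum Q Ω)
    {Φ : (Q → Set S) → Q → Set S} (hΦ : OpMono Φ) (e : Q → Set S) (q : Q) (s : S) :
    s ∈ sol (fun k => Even (Ω (E.en k))) E.en Φ E.n e q ∨
      Wins (opDual Φ) (fun q => Ω q + 1) q s := by
  by_cases h : s ∈ sol (fun k => Even (Ω (E.en k))) E.en Φ E.n e q
  · exact Or.inl h
  · right
    let E' : Enum Q (fun q => Ω q + 1) := ⟨E.n, E.en, E.idx, E.idx_en, E.en_idx, E.idx_lt,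
      fun q q' h => Nat.add_le_add_right (E.mono q q' h) 1⟩
    have h2 := congrFun (sol_compl (fun k => Even (Ω (E.en k))) E.en Φ E.n e) q
    have h3 : s ∈ sol (fun k => ¬ Even (Ω (E.en k))) E.en (opDual Φ) E.n (fun q => (e q)ᶜ) q :=
      h2 ▸ h
    refine sol_wins E' hΦ.dual (e := fun q => (e q)ᶜ) ?_
    rwa [sol_congr (ν' := fun k => ¬ Even (Ω (E.en k)))
      (fun k => by simp [E', Nat.even_add_one]) (fun _ _ => rfl)]

theorem wins_iff_sol {Q S : Type} {Ω : Q → ℕ} (E : Enum Q Ω) {Φ : (Q → Set S) → Q → Set S}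
    (hΦ : OpMono Φ) (e : Q → Set S) (q : Q) (s : S) :
    Wins Φ Ω q s ↔ s ∈ sol (fun k => Even (Ω (E.en k))) E.en Φ E.n e q :=
  ⟨fun h => (mem_sol_or_dual_wins E hΦ e q s).resolve_right (not_wins_and_dual hΦ h),
    sol_wins E hΦ⟩

/-- Positional determinacy. -/
theorem not_wins_iff {Q S : Type} [Finite Q] {Ω : Q → ℕ} {Φ : (Q → Set S) → Q → Set S}
    (hΦ : OpMono Φ) (q : Q) (s : S) :
    ¬ Wins Φ Ω q s ↔ Wins (opDual Φ) (fun q => Ω q + 1) q s := by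
  have : Nonempty Q := ⟨q⟩
  obtain ⟨E⟩ := exists_enum Q Ω
  exact ⟨fun h => (mem_sol_or_dual_wins E hΦ (fun _ => ∅) q s).resolve_left
    fun h' => h (sol_wins E hΦ h'), fun h h' => not_wins_and_dual hΦ h' h⟩

/-! ### Determinization over finite monoids -/

theorem par_iff_even {a : ℕ → ℕ} {v : ℕ} (h1 : ∀ N, ∃ i ≥ N, a i = v)
    (h2 : ∃ N, ∀ i ≥ N, a i ≤ v) : Par a ↔ Even v := by
  constructor
  · rintro ⟨m, hm, h3, N', h4⟩
    obtain ⟨N, h2⟩ := h2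
    obtain ⟨i, hi, e⟩ := h1 N'
    obtain ⟨j, hj, e'⟩ := h3 N
    have h5 := h4 i hi
    have h6 := h2 j hj
    obtain rfl : m = v := by omega
    exact hm
  · exact fun h => ⟨v, h, h1, h2⟩

theorem par_shift_iff {a : ℕ → ℕ} (k : ℕ) : Par (fun i => a (i + k)) ↔ Par a := by
  refine ⟨Par.of_shift k, fun ⟨m, hm, h1, N, h2⟩ => ⟨m, hm, fun M => ?_, N, fun i hi => ?_⟩⟩
  · obtain ⟨i, hi, e⟩ := h1 (M + k)
    exact ⟨i - k, by omega, by rw [← e]; exact congrArg a (by omega)⟩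
  · exact h2 (i + k) (by omega)

/-- The product `w i * ⋯ * w (j - 1)`. -/
noncomputable def seg {S : Type} [Monoid S] (w : ℕ → S) (i : ℕ) : ℕ → S
  | 0 => 1
  | j + 1 => if i ≤ j then seg w i j * w j else 1

theorem seg_self {S : Type} [Monoid S] (w : ℕ → S) (i : ℕ) : seg w i i = 1 := by
  cases i <;> simp [seg]

theorem seg_succ {S : Type} [Monoid S] (w : ℕ → S) {i j : ℕ} (h : i ≤ j) :
    seg w i (j + 1) = seg w i j * w j := by
  simp [seg, h]

theorem seg_mul {S : Type} [Monoid S] (w : ℕ → S) {i j k : ℕ} (h : i ≤ j) (h' : j ≤ k) :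
    seg w i j * seg w j k = seg w i k := by
  induction k, h' using Nat.le_induction with
  | base => rw [seg_self, mul_one]
  | succ k hk ih => rw [seg_succ w hk, seg_succ w (h.trans hk), ← mul_assoc, ih]

/-- A language of infinite words over a monoid that is insensitive to multiplying out
finite blocks. -/
def Contractible {S : Type} [Monoid S] (L : (ℕ → S) → Prop) : Prop :=
  ∀ (w : ℕ → S) (c : ℕ → ℕ), StrictMono c → c 0 = 0 →
    (L w ↔ L fun n => seg w (c n) (c (n + 1)))

/-- Membership of the ultimately periodic word `(s f) f f f …`. -/
def Periodic {S : Type} [Monoid S] (L : (ℕ → S) → Prop) (s f : S) : Prop :=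
  L fun n => if n = 0 then s * f else f

theorem Contractible.periodic_congr {S : Type} [Monoid S] {L : (ℕ → S) → Prop}
    (hL : Contractible L) (s : S) {f f' : S} (h : f * f' = f') (h' : f' * f = f) :
    Periodic L s f ↔ Periodic L s f' := by
  set w : ℕ → S := fun n => if n = 0 then s * f' else if n % 2 = 1 then f else f' with hw
  have e1 := hL w (fun n => 2 * n) (fun a b hab => by simp only; omega) rfl
  have e2 := hL w (fun n => 2 * n - 1) (strictMono_nat_of_lt_succ fun n => by omega) rfl
  have e3 : (fun n => seg w (2 * n) (2 * (n + 1))) = fun n => if n = 0 then s * f else f := by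
    funext n
    rw [show 2 * (n + 1) = 2 * n + 1 + 1 by ring, seg_succ w (by omega), seg_succ w le_rfl,
      seg_self, one_mul]
    by_cases hn : n = 0
    · subst hn
      simp [hw, mul_assoc, h']
    · simp [hw, hn, h', Nat.add_mod]
  have e4 : (fun n => seg w (2 * n - 1) (2 * (n + 1) - 1)) =
      fun n => if n = 0 then s * f' else f' := by
    funext n
    cases n with
    | zero => simp [seg, hw]
    | succ n =>
      rw [show 2 * (n + 1 + 1) - 1 = 2 * n + 1 + 1 + 1 by omega,
        show 2 * (n + 1) - 1 = 2 * n + 1 by omega, seg_succ w (by omega), seg_succ w le_rfl,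
        seg_self, one_mul]
      simp [hw, h, Nat.add_mod]
  unfold Periodic
  rw [← e3, ← e4, ← e1, ← e2]

/-- The acceptance bit attached to a surviving candidate. -/
def accBit {S : Type} [Monoid S] (L : (ℕ → S) → Prop) (s e : S) : Prop :=
  ∃ f u, f * f = f ∧ e * u = f ∧ f * e = e ∧ Periodic L s f

theorem Contractible.eventually_accBit {S : Type} [Monoid S] [Finite S] {L : (ℕ → S) → Prop}
    (hL : Contractible L) (w : ℕ → S) (y : ℕ)
    (hinf : ∀ N, ∃ h ≥ N, ∃ k ≥ h, seg w y k = seg w h k) :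
    ∃ K, ∀ k ≥ K, (accBit L (seg w 0 y) (seg w y k) ↔ L w) := by
  obtain ⟨f, hf⟩ : ∃ f, ∀ N, ∃ h ≥ N, y < h ∧ (∃ k ≥ h, seg w y k = seg w h k) ∧
      seg w y h = f := by
    by_contra hcon
    push Not at hcon
    choose N hN using hcon
    obtain ⟨B, hB⟩ := (Set.finite_range N).bddAbove
    obtain ⟨h, hh, hk⟩ := hinf (max B (y + 1))
    exact hN (seg w y h) h ((hB ⟨_, rfl⟩).trans ((le_max_left _ _).trans hh))
      (by have := le_max_right B (y + 1); omega) hk rfl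
  choose h hhN hyh hk hseg using hf
  choose M hM hMe using hk
  have hmerge : ∀ N n, M N ≤ n → seg w y n = seg w (h N) n := by
    intro N n hn
    rw [← seg_mul w (by have := hM N; have := hyh N; omega) hn, hMe,
      seg_mul w (hM N) hn]
  let t : ℕ → ℕ := fun i => Nat.rec 0 (fun _ x => M x + 1) i
  have ht : ∀ i, t (i + 1) = M (t i) + 1 := fun i => rfl
  have hlt : ∀ i, M (t i) ≤ h (t (i + 1)) := fun i => by
    have := hhN (t (i + 1))
    rw [ht] at this ⊢
    omega
  have hblock : ∀ i, seg w (h (t i)) (h (t (i + 1))) = f := fun i => by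
    rw [← hmerge _ _ (hlt i), hseg]
  let c : ℕ → ℕ := fun n => Nat.casesOn n 0 fun i => h (t i)
  have hc : StrictMono c := by
    refine strictMono_nat_of_lt_succ fun n => ?_
    cases n with
    | zero => exact (Nat.zero_le y).trans_lt (hyh _)
    | succ n =>
      have h1 := hM (t n)
      have h2 := hhN (t (n + 1))
      rw [ht] at h2
      change h (t n) < h (t (n + 1))
      rw [ht]
      omega
  have hword : (fun n => seg w (c n) (c (n + 1))) =
      fun n => if n = 0 then seg w 0 y * f else f := by
    funext n
    cases n with
    | zero =>
      change seg w 0 (h (t 0)) = _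
      rw [if_pos rfl, ← hseg (t 0), seg_mul w (Nat.zero_le _) (hyh _).le]
    | succ n => exact hblock n
  have hLw : L w ↔ Periodic L (seg w 0 y) f := by
    rw [hL w c hc rfl, hword, Periodic]
  have hff : f * f = f := by
    have h1 := seg_mul w (hyh (t 0)).le ((hM (t 0)).trans (hlt 0))
    rwa [hblock 0, hseg, hseg] at h1
  refine ⟨M 0, fun k hk => ?_⟩
  have hfe : f * seg w y k = seg w y k := by
    rw [hmerge 0 k hk, ← hseg 0, seg_mul w (hyh 0).le ((hM 0).trans hk), ← hmerge 0 k hk]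
  have hu : seg w y k * seg w k (h k) = f := by
    rw [seg_mul w (by have := hyh 0; have := hM 0; omega) (hhN k), hseg]
  constructor
  · rintro ⟨f', u', hf', hu', hfe', hP⟩
    rw [hLw, hL.periodic_congr _ (f' := f') _ _]
    · exact hP
    · rw [← hu', ← mul_assoc, hfe]
    · rw [← hu, ← mul_assoc, hfe']
  · intro hw
    exact ⟨f, _, hff, hu, hfe, hLw.1 hw⟩

/-! #### Removing duplicates from lists of candidates -/

section Reduce

variable {α β κ : Type}

/-- Remove every element whose key recurs further down the list. -/
noncomputable def reduce (key : α → κ) : List α → List α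
  | [] => []
  | h :: t => if ∃ y ∈ t, key y = key h then reduce key t else h :: reduce key t

/-- The deepest removal performed by `reduce`: the length of the list below the removed
element, and the element it is identified with. -/
noncomputable def firstMerge (key : α → κ) : List α → Option (ℕ × α)
  | [] => none
  | h :: t =>
    match firstMerge key t with
    | some x => some x
    | none => (t.find? fun y => decide (key y = key h)).map fun y => (t.length, y)

theorem reduce_sublist (key : α → κ) (l : List α) : (reduce key l).Sublist l := by
  induction l with
  | nil => exact List.Sublist.refl _
  | cons h t ih =>
    rw [reduce]
    split_ifs
    · exact ih.cons _
    · exact ih.cons_cons _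

theorem reduce_nodup (key : α → κ) (l : List α) : ((reduce key l).map key).Nodup := by
  induction l with
  | nil => simp [reduce]
  | cons h t ih =>
    rw [reduce]
    split_ifs with hy
    · exact ih
    · rw [List.map_cons, List.nodup_cons]
      refine ⟨fun hmem => hy ?_, ih⟩
      obtain ⟨y, hyt, e⟩ := List.mem_map.1 hmem
      exact ⟨y, (reduce_sublist key t).subset hyt, e⟩

theorem reduce_eq_of_firstMerge (key : α → κ) (l : List α) (h : firstMerge key l = none) :
    reduce key l = l := by
  induction l with
  | nil => rfl
  | cons a t ih =>
    rw [firstMerge] at h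
    rw [reduce]
    cases ht : firstMerge key t with
    | some x => simp [ht] at h
    | none =>
      simp only [ht, Option.map_eq_none_iff, List.find?_eq_none, decide_eq_true_eq] at h
      rw [if_neg (by push Not; exact h), ih ht]

theorem reduce_append (key : α → κ) (l l' : List α) :
    ∃ p, reduce key (l ++ l') = p ++ reduce key l' ∧ p.Sublist l := by
  induction l with
  | nil => exact ⟨[], rfl, List.Sublist.refl _⟩
  | cons a t ih =>
    obtain ⟨p, hp, hs⟩ := ih
    rw [List.cons_append, reduce]
    split_ifs
    · exact ⟨p, hp, hs.cons _⟩
    · exact ⟨a :: p, by rw [hp, List.cons_append], hs.cons_cons _⟩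

theorem firstMerge_split (key : α → κ) (l : List α) {m : ℕ} {y : α}
    (h : firstMerge key l = some (m, y)) :
    ∃ a t, a :: t <:+ l ∧ t.length = m ∧ y ∈ t ∧ key y = key a ∧ reduce key (a :: t) = t := by
  induction l with
  | nil => simp [firstMerge] at h
  | cons b t ih =>
    rw [firstMerge] at h
    cases ht : firstMerge key t with
    | some x =>
      simp only [ht, Option.some.injEq] at h
      obtain ⟨a, t', h1, h2⟩ := ih (by rw [ht, h])
      exact ⟨a, t', h1.trans (List.suffix_cons _ _), h2⟩
    | none =>
      simp only [ht, Option.map_eq_some_iff, Prod.mk.injEq] at h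
      obtain ⟨z, hz, rfl, rfl⟩ := h
      have hk : key z = key b := by simpa using List.find?_some hz
      have hmem := List.mem_of_find?_eq_some hz
      refine ⟨b, t, List.suffix_rfl, rfl, hmem, hk, ?_⟩
      rw [reduce, if_pos ⟨z, hmem, hk⟩, reduce_eq_of_firstMerge key t ht]

theorem firstMerge_spec (key : α → κ) {l : List α} (hl : l.Nodup) {m : ℕ} {y : α}
    (h : firstMerge key l = some (m, y)) :
    ∃ a t, a :: t <:+ l ∧ t.length = m ∧ y ∈ t ∧ key y = key a ∧ t <:+ reduce key l ∧
      a ∉ reduce key l := by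
  obtain ⟨a, t, ⟨p, rfl⟩, h2, h3, h4, h5⟩ := firstMerge_split key l h
  obtain ⟨p', hp', hs⟩ := reduce_append key p (a :: t)
  rw [h5] at hp'
  refine ⟨a, t, ⟨p, rfl⟩, h2, h3, h4, ⟨p', hp'.symm⟩, fun hmem => ?_⟩
  rw [hp', List.mem_append] at hmem
  rw [List.nodup_append] at hl
  rcases hmem with hmem | hmem
  · exact hl.2.2 a (hs.subset hmem) a (by simp) rfl
  · exact (List.nodup_cons.1 hl.2.1).1 hmem

theorem reduce_map (key : β → κ) (g : α → β) (l : List α) :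
    reduce key (l.map g) = (reduce (key ∘ g) l).map g := by
  induction l with
  | nil => rfl
  | cons h t ih =>
    rw [List.map_cons, reduce, reduce, ih]
    simp only [List.mem_map, exists_exists_and_eq_and, Function.comp_apply]
    split_ifs <;> simp

theorem firstMerge_map (key : β → κ) (g : α → β) (l : List α) :
    firstMerge key (l.map g) = (firstMerge (key ∘ g) l).map fun x => (x.1, g x.2) := by
  induction l with
  | nil => rfl
  | cons h t ih =>
    rw [List.map_cons, firstMerge, firstMerge, ih]
    cases firstMerge (key ∘ g) t with
    | some x => rfl
    | none =>
      simp [List.find?_map, Function.comp_def]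

end Reduce


/-! #### The deterministic automaton -/

section Det

variable {S : Type} [Monoid S] (w : ℕ → S)

/-- The surviving positions after reading `n` letters, most recent first. -/
noncomputable def survivors : ℕ → List ℕ
  | 0 => [0]
  | n + 1 => reduce (fun x => seg w x (n + 1)) ((n + 1) :: survivors n)

/-- The deepest merge happening while reading letter `n`. -/
noncomputable def mergeAt (n : ℕ) : Option (ℕ × ℕ) :=
  firstMerge (fun x => seg w x (n + 1)) ((n + 1) :: survivors w n)

theorem survivors_le (n : ℕ) : ∀ x ∈ survivors w n, x ≤ n := by
  induction n with
  | zero => simp [survivors]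
  | succ n ih =>
    intro x hx
    rcases List.mem_cons.1 ((reduce_sublist _ _).subset hx) with rfl | h
    · exact le_rfl
    · exact (ih x h).trans (Nat.le_succ n)

theorem survivors_mono {n n' x : ℕ} (h : n ≤ n') (hx : x ≤ n) (hn : x ∉ survivors w n) :
    x ∉ survivors w n' := by
  induction n', h using Nat.le_induction with
  | base => exact hn
  | succ k hk ih =>
    intro hmem
    rcases List.mem_cons.1 ((reduce_sublist _ _).subset hmem) with rfl | h
    · omega
    · exact ih h

theorem survivors_cons_nodup (n : ℕ) : ((n + 1) :: survivors w n).Nodup := by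
  rw [List.nodup_cons]
  refine ⟨fun h => by have := survivors_le w n _ h; omega, ?_⟩
  induction n with
  | zero => simp [survivors]
  | succ n ih =>
    refine List.Nodup.sublist (reduce_sublist _ _) (List.nodup_cons.2 ⟨fun h => ?_, ih⟩)
    have := survivors_le w n _ h
    omega

theorem survivors_length_le [Finite S] (n : ℕ) : (survivors w n).length ≤ Nat.card S := by
  have h : ((survivors w n).map fun x => seg w x n).Nodup := by
    cases n with
    | zero => simp [survivors]
    | succ n => exact reduce_nodup _ _
  have := Fintype.ofFinite S
  simpa [Nat.card_eq_fintype_card] using h.length_le_card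

theorem mergeAt_spec {n m y : ℕ} (h : mergeAt w n = some (m, y)) :
    ∃ a t, a :: t <:+ (n + 1) :: survivors w n ∧ t.length = m ∧ y ∈ t ∧
      seg w y (n + 1) = seg w a (n + 1) ∧ t <:+ survivors w (n + 1) ∧
      a ∉ survivors w (n + 1) :=
  firstMerge_spec _ (survivors_cons_nodup w n) h

theorem survivors_succ_of_mergeAt {n : ℕ} (h : mergeAt w n = none) :
    survivors w (n + 1) = (n + 1) :: survivors w n :=
  reduce_eq_of_firstMerge _ _ h

theorem mergeAt_le [Finite S] {n m y : ℕ} (h : mergeAt w n = some (m, y)) : m ≤ Nat.card S := by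
  obtain ⟨a, t, -, rfl, -, -, h1, -⟩ := mergeAt_spec w h
  exact h1.length_le.trans (survivors_length_le w _)

theorem mergeAt_frequently [Finite S] (N : ℕ) : ∃ n ≥ N, ∃ x, mergeAt w n = some x := by
  by_contra! hcon
  have h : ∀ k, k ≤ (survivors w (N + k)).length := by
    intro k
    induction k with
    | zero => exact Nat.zero_le _
    | succ k ih =>
      rw [← add_assoc, survivors_succ_of_mergeAt w]
      · simpa using ih
      · exact Option.eq_none_iff_forall_ne_some.2 (hcon (N + k) (by omega))
  have := (h (Nat.card S + 1)).trans (survivors_length_le w _)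
  omega

theorem eventually_forall_lt {P : ℕ → ℕ → Prop} (B : ℕ) (h : ∀ m < B, ∃ N, ∀ n ≥ N, P n m) :
    ∃ N, ∀ n ≥ N, ∀ m < B, P n m := by
  choose! N hN using h
  refine ⟨(Finset.range B).sup N, fun n hn m hm => hN m hm n ?_⟩
  exact (Finset.le_sup (f := N) (Finset.mem_range.2 hm)).trans hn

theorem exists_critical_depth [Finite S] :
    ∃ m, (∀ N, ∃ n ≥ N, ∃ y, mergeAt w n = some (m, y)) ∧
      ∃ N, ∀ n ≥ N, ∀ m' y, mergeAt w n = some (m', y) → m ≤ m' := by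
  have hex : ∃ m, ∀ N, ∃ n ≥ N, ∃ y, mergeAt w n = some (m, y) := by
    by_contra! hcon
    obtain ⟨N, hN⟩ := eventually_forall_lt (P := fun n m => ∀ y, mergeAt w n ≠ some (m, y))
      (Nat.card S + 1) fun m _ => hcon m
    obtain ⟨n, hn, ⟨m, y⟩, hx⟩ := mergeAt_frequently w N
    exact hN n hn m (by have := mergeAt_le w hx; omega) y hx
  refine ⟨Nat.find hex, Nat.find_spec hex, ?_⟩
  obtain ⟨N, hN⟩ := eventually_forall_lt (P := fun n m => ∀ y, mergeAt w n ≠ some (m, y))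
    (Nat.find hex) fun m hm => by
      have := Nat.find_min hex hm
      push Not at this
      exact this
  refine ⟨N, fun n hn m' y h => ?_⟩
  by_contra! hlt
  exact hN n hn m' hlt y h

theorem exists_stable_suffix {m N : ℕ} (h1 : ∀ N, ∃ n ≥ N, ∃ y, mergeAt w n = some (m, y))
    (h2 : ∀ n ≥ N, ∀ m' y, mergeAt w n = some (m', y) → m ≤ m') :
    ∃ Y : List ℕ, ∃ N', ∀ n ≥ N', ∀ y, mergeAt w n = some (m, y) → y ∈ Y := by
  obtain ⟨n₁, hn₁, y₁, he₁⟩ := h1 N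
  obtain ⟨a₁, Y, -, hlen, -, -, hY₁, -⟩ := mergeAt_spec w he₁
  have hsuf : ∀ n ≥ n₁ + 1, Y <:+ survivors w n := by
    intro n hn
    induction n, hn using Nat.le_induction with
    | base => exact hY₁
    | succ n hn ih =>
      have ih' := ih.trans (List.suffix_cons (n + 1) _)
      cases he : mergeAt w n with
      | none => rwa [survivors_succ_of_mergeAt w he]
      | some x =>
        obtain ⟨m', y⟩ := x
        have hm := h2 n (by omega) m' y he
        obtain ⟨a, t, h3, rfl, -, -, h4, -⟩ := mergeAt_spec w he
        exact (List.suffix_of_suffix_length_le ih' ((List.suffix_cons a t).trans h3)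
          (hlen.trans_le hm)).trans h4
  refine ⟨Y, n₁ + 1, fun n hn y he => ?_⟩
  obtain ⟨a, t, h3, ht, hy, -, -, -⟩ := mergeAt_spec w he
  exact (List.suffix_of_suffix_length_le ((List.suffix_cons a t).trans h3)
    ((hsuf n hn).trans (List.suffix_cons _ _)) (by omega)).subset hy

theorem merge_target_recurs {m y : ℕ} (h : ∀ N, ∃ n ≥ N, mergeAt w n = some (m, y)) (N : ℕ) :
    ∃ h ≥ N, ∃ k ≥ h, seg w y k = seg w h k := by
  have hs : {n | mergeAt w n = some (m, y)}.Infinite := by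
    refine Set.infinite_of_not_bddAbove fun ⟨B, hB⟩ => ?_
    obtain ⟨n, hn, he⟩ := h (B + 1)
    have := hB he
    omega
  have hspec : ∀ n, mergeAt w n = some (m, y) → ∃ a, a ∈ (n + 1) :: survivors w n ∧
      seg w y (n + 1) = seg w a (n + 1) ∧ a ∉ survivors w (n + 1) := by
    intro n hn
    obtain ⟨a, t, h1, -, -, h2, -, h3⟩ := mergeAt_spec w hn
    exact ⟨a, h1.subset (by simp), h2, h3⟩
  choose! a ha using hspec
  have hle : ∀ n, mergeAt w n = some (m, y) → a n ≤ n + 1 := by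
    intro n hn
    rcases List.mem_cons.1 (ha n hn).1 with e | e
    · exact e.le
    · exact (survivors_le w n _ e).trans (Nat.le_succ n)
  have hne : ∀ n n', mergeAt w n = some (m, y) → mergeAt w n' = some (m, y) → n < n' →
      a n ≠ a n' := by
    intro n n' hn hn' hlt e
    have h1 := survivors_mono w (n' := n') hlt (hle n hn) (ha n hn).2.2
    rcases List.mem_cons.1 (ha n' hn').1 with e' | e'
    · have := hle n hn
      omega
    · exact h1 (e ▸ e')
  have hinj : Set.InjOn a {n | mergeAt w n = some (m, y)} := by
    intro n hn n' hn' e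
    rcases lt_trichotomy n n' with hlt | rfl | hlt
    · exact absurd e (hne n n' hn hn' hlt)
    · rfl
    · exact absurd e.symm (hne n' n hn' hn hlt)
  obtain ⟨b, ⟨n, hn, rfl⟩, hb⟩ := (hs.image hinj).exists_gt N
  exact ⟨a n, hb.le, n + 1, hle n hn, (ha n hn).2.1⟩

/-- The priority issued at a merge. -/
noncomputable def mergePrio (L : (ℕ → S) → Prop) : Option (ℕ × S × S) → ℕ
  | none => 0
  | some (m, v, p) => 2 * (Nat.card S - m) + if accBit L p v then 2 else 1

theorem Contractible.par_mergePrio [Finite S] {L : (ℕ → S) → Prop} (hL : Contractible L) :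
    L w ↔ Par fun n => mergePrio L
      ((mergeAt w n).map fun x => (x.1, seg w x.2 (n + 1), seg w 0 x.2)) := by
  obtain ⟨m, h1, N, h2⟩ := exists_critical_depth w
  obtain ⟨Y, N', hY⟩ := exists_stable_suffix w h1 h2
  have hbit : ∀ y, ∃ K, ∀ n ≥ K, mergeAt w n = some (m, y) →
      (accBit L (seg w 0 y) (seg w y (n + 1)) ↔ L w) := by
    intro y
    by_cases hy : ∀ N, ∃ n ≥ N, mergeAt w n = some (m, y)
    · obtain ⟨K, hK⟩ := hL.eventually_accBit w y (merge_target_recurs w hy)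
      exact ⟨K, fun n hn _ => hK (n + 1) (by omega)⟩
    · push Not at hy
      obtain ⟨K, hK⟩ := hy
      exact ⟨K, fun n hn he => absurd he (hK n hn)⟩
  choose K hK using hbit
  have hbit' : ∃ M, ∀ n ≥ M, ∀ y, mergeAt w n = some (m, y) →
      (accBit L (seg w 0 y) (seg w y (n + 1)) ↔ L w) := by
    refine ⟨max N' (Y.toFinset.sup K), fun n hn y he => hK y n ?_ he⟩
    have hy := hY n ((le_max_left _ _).trans hn) y he
    exact (Finset.le_sup (f := K) (List.mem_toFinset.2 hy)).trans ((le_max_right _ _).trans hn)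
  obtain ⟨M, hM⟩ := hbit'
  rw [par_iff_even (v := 2 * (Nat.card S - m) + if L w then 2 else 1)]
  · split_ifs with h <;> simp [h, parity_simps]
  · intro N₀
    obtain ⟨n, hn, y, he⟩ := h1 (max N₀ M)
    refine ⟨n, (le_max_left _ _).trans hn, ?_⟩
    simp only [he, Option.map_some, mergePrio, hM n ((le_max_right _ _).trans hn) y he]
  · refine ⟨max N M, fun n hn => ?_⟩
    cases he : mergeAt w n with
    | none => simp [mergePrio]
    | some x =>
      obtain ⟨m', y⟩ := x
      have h3 := h2 n ((le_max_left _ _).trans hn) m' y he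
      have h4 := mergeAt_le w he
      rcases h3.eq_or_lt with rfl | h3
      · simp only [Option.map_some, mergePrio, hM n ((le_max_right _ _).trans hn) y he, le_refl]
      · simp only [Option.map_some, mergePrio]
        split_ifs <;> omega

end Det

/-- A language that is insensitive to multiplying out finite blocks is recognized by a
deterministic parity automaton. -/
theorem exists_det {S : Type} [Finite S] [Monoid S] {L : (ℕ → S) → Prop}
    (hL : Contractible L) :
    ∃ (M : Type) (_ : Finite M) (m₀ : M) (δ : M → S → M) (Ω : M → ℕ),
      ∀ (w : ℕ → S) (r : ℕ → M), r 0 = m₀ → (∀ n, r (n + 1) = δ (r n) (w n)) →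
        (L w ↔ Par (Ω ∘ r)) := by
  let M := {x : S × List (S × S) × Fin (2 * Nat.card S + 3) // (x.2.1.map Prod.fst).Nodup}
  have hprio : ∀ x, mergePrio L x < 2 * Nat.card S + 3 := by
    intro x
    rcases x with _ | ⟨m, v, p⟩
    · simp [mergePrio]
    · simp only [mergePrio]
      split_ifs <;> omega
  let l' : S × List (S × S) × Fin (2 * Nat.card S + 3) → S → List (S × S) := fun x a =>
    (1, x.1 * a) :: x.2.1.map fun v => (v.1 * a, v.2)
  have hfin : Finite M := by
    have := Fintype.ofFinite S
    have h := List.finite_length_le (S × S) (Nat.card S)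
    have h' : Set.Finite (Set.univ ×ˢ ({l : List (S × S) | l.length ≤ Nat.card S} ×ˢ
      (Set.univ : Set (Fin (2 * Nat.card S + 3)))) : Set (S × _ × _)) :=
      Set.finite_univ.prod (h.prod Set.finite_univ)
    refine Set.Finite.to_subtype (h'.subset fun x (hx : (x.2.1.map Prod.fst).Nodup) => ?_)
    refine ⟨trivial, ?_, trivial⟩
    have := List.Nodup.length_le_card hx
    simpa [Nat.card_eq_fintype_card] using this
  refine ⟨M, hfin, ⟨(1, [(1, 1)], 0), by simp⟩, fun x a => ⟨(x.1.1 * a,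
    reduce Prod.fst (l' x.1 a), ⟨mergePrio L (firstMerge Prod.fst (l' x.1 a)), hprio _⟩),
    reduce_nodup _ _⟩, fun x => x.1.2.2, fun w r h0 hr => ?_⟩
  have hl : ∀ n, (r n).1.1 = seg w 0 n →
      ((r n).1.2.1 = (survivors w n).map fun x => (seg w x n, seg w 0 x)) →
      l' (r n).1 (w n) =
        ((n + 1) :: survivors w n).map fun x => (seg w x (n + 1), seg w 0 x) := by
    intro n h1 h2
    simp only [l', h1, h2, List.map_cons, List.map_map, seg_self, ← seg_succ w (Nat.zero_le n)]
    congr 1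
    refine List.map_congr_left fun x hx => ?_
    simp [seg_succ w (survivors_le w n x hx)]
  have key : ∀ n, (r n).1.1 = seg w 0 n ∧
      (r n).1.2.1 = (survivors w n).map fun x => (seg w x n, seg w 0 x) := by
    intro n
    induction n with
    | zero => simp [h0, seg, survivors]
    | succ n ih =>
      rw [hr]
      refine ⟨by rw [seg_succ w (Nat.zero_le n), ← ih.1], ?_⟩
      simp only [hl n ih.1 ih.2, survivors]
      rw [reduce_map]
      rfl
  have hΩ : ∀ n, ((r (n + 1)).1.2.2 : ℕ) = mergePrio L
      ((mergeAt w n).map fun x => (x.1, seg w x.2 (n + 1), seg w 0 x.2)) := by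
    intro n
    rw [hr]
    simp only [hl n (key n).1 (key n).2, firstMerge_map]
    rfl
  rw [hL.par_mergePrio, ← par_shift_iff (a := (fun x : M => (x.1.2.2 : ℕ)) ∘ r) 1]
  simp only [Function.comp_def, hΩ]

/-! ### Trace profiles -/

/-- Sets of labelled transitions on `Q`, the labels being priorities at most `K`. -/
def Profile (Q : Type) (K : ℕ) : Type := Set (Q × Fin (K + 1) × Q)

namespace Profile

variable {Q : Type} {K : ℕ}

instance [Finite Q] : Finite (Profile Q K) := inferInstanceAs (Finite (Set _))

instance : Membership (Q × Fin (K + 1) × Q) (Profile Q K) := inferInstanceAs (Membership _ (Set _))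

theorem ext {s t : Profile Q K} (h : ∀ x, x ∈ s ↔ x ∈ t) : s = t := Set.ext h

instance : Monoid (Profile Q K) where
  one := {x : Q × Fin (K + 1) × Q | x.1 = x.2.2 ∧ x.2.1 = 0}
  mul s t := {x : Q × Fin (K + 1) × Q |
    ∃ q a b, (x.1, a, q) ∈ s ∧ (q, b, x.2.2) ∈ t ∧ x.2.1 = a ⊔ b}
  mul_assoc r s t := by
    refine ext fun x => ⟨?_, ?_⟩
    · rintro ⟨q, a, b, ⟨q', a', b', h1, h2, h3⟩, h4, h5⟩
      exact ⟨q', a', b' ⊔ b, h1, ⟨q, b', b, h2, h4, rfl⟩, by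
        rw [h5, ← sup_assoc]
        exact congrArg (· ⊔ b) h3⟩
    · rintro ⟨q, a, b, h4, ⟨q', a', b', h1, h2, h3⟩, h5⟩
      exact ⟨q', a ⊔ a', b', ⟨q, a, a', h4, h1, rfl⟩, h2, by
        rw [h5, sup_assoc]
        exact congrArg (a ⊔ ·) h3⟩
  one_mul s := by
    refine ext fun x => ⟨?_, fun h => ⟨x.1, 0, x.2.1, ⟨rfl, rfl⟩, h, by simp⟩⟩
    rintro ⟨q, a, b, ⟨h1, h2⟩, h4, h5⟩
    obtain ⟨p, v, p'⟩ := x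
    simp only at h1 h2 h4 h5
    subst h1 h2
    simpa [h5] using h4
  mul_one s := by
    refine ext fun x => ⟨?_, fun h => ⟨x.2.2, x.2.1, 0, h, ⟨rfl, rfl⟩, by simp⟩⟩
    rintro ⟨q, a, b, h4, ⟨h1, h2⟩, h5⟩
    obtain ⟨p, v, p'⟩ := x
    simp only at h1 h2 h4 h5
    subst h1 h2
    simpa [h5] using h4

theorem mem_one {x : Q × Fin (K + 1) × Q} :
    x ∈ (1 : Profile Q K) ↔ x.1 = x.2.2 ∧ x.2.1 = 0 := Iff.rfl

theorem mem_mul {s t : Profile Q K} {x : Q × Fin (K + 1) × Q} :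
    x ∈ s * t ↔ ∃ q a b, (x.1, a, q) ∈ s ∧ (q, b, x.2.2) ∈ t ∧ x.2.1 = a ⊔ b := Iff.rfl

theorem mem_seg_of_run (w : ℕ → Profile Q K) (τ : ℕ → Q) (a : ℕ → Fin (K + 1)) {i j : ℕ}
    (hij : i ≤ j) (h : ∀ k, i ≤ k → k < j → (τ k, a k, τ (k + 1)) ∈ w k) :
    (τ i, (Finset.Ico i j).sup a, τ j) ∈ seg w i j := by
  induction j, hij using Nat.le_induction with
  | base => simp [seg_self, mem_one, bot_eq_zero]
  | succ j hj ih =>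
    rw [seg_succ w hj, mem_mul]
    refine ⟨τ j, _, a j, ih fun k hk hk' => h k hk (by omega), h j hj (by omega), ?_⟩
    rw [← Finset.insert_Ico_right_eq_Ico_add_one hj, Finset.sup_insert, sup_comm]

theorem exists_run_of_mem_seg (w : ℕ → Profile Q K) {i j : ℕ} (hij : i ≤ j) {p q : Q}
    {v : Fin (K + 1)} (h : (p, v, q) ∈ seg w i j) :
    ∃ (τ : ℕ → Q) (a : ℕ → Fin (K + 1)), τ i = p ∧ τ j = q ∧
      (∀ k, i ≤ k → k < j → (τ k, a k, τ (k + 1)) ∈ w k) ∧ (Finset.Ico i j).sup a = v := by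
  induction j, hij using Nat.le_induction generalizing q v with
  | base =>
    rw [seg_self, mem_one] at h
    obtain ⟨h1, h2⟩ := h
    simp only at h1 h2
    exact ⟨fun _ => p, fun _ => 0, rfl, h1, fun k _ _ => by omega, by simp [h2, bot_eq_zero]⟩
  | succ j hj ih =>
    rw [seg_succ w hj, mem_mul] at h
    obtain ⟨q', b, b', h1, h2, h3⟩ := h
    obtain ⟨τ, a, h4, h5, h6, h7⟩ := ih h1
    refine ⟨fun k => if k = j + 1 then q else τ k, fun k => if k = j then b' else a k,
      ?_, by simp, fun k hk hk' => ?_, ?_⟩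
    · simp only
      rw [if_neg (by omega), h4]
    · simp only
      rw [if_neg (by omega)]
      by_cases hkj : k = j
      · subst hkj
        rw [if_pos rfl, if_pos rfl, h5]
        exact h2
      · rw [if_neg hkj, if_neg (by omega)]
        exact h6 k hk (by omega)
    · rw [← Finset.insert_Ico_right_eq_Ico_add_one hj, Finset.sup_insert, sup_comm]
      simp only at h3
      rw [h3, if_pos rfl, ← h7]
      congr 1
      refine Finset.sup_congr rfl fun k hk => ?_
      rw [if_neg (by have := Finset.mem_Ico.1 hk; omega)]

end Profile

/-- The block of a strictly increasing sequence containing a position. -/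
theorem exists_block {c : ℕ → ℕ} (hc : StrictMono c) (h0 : c 0 = 0) (i : ℕ) :
    ∃ n, c n ≤ i ∧ i < c (n + 1) := by
  have h : ∃ n, i < c (n + 1) := ⟨i, hc.le_apply.trans_lt (hc (Nat.lt_succ_self i))⟩
  refine ⟨Nat.find h, ?_, Nat.find_spec h⟩
  cases hn : Nat.find h with
  | zero => simp [h0]
  | succ k =>
    have := Nat.find_min h (m := k) (by omega)
    omega

theorem block_unique {c : ℕ → ℕ} (hc : StrictMono c) {i n m : ℕ} (h1 : c n ≤ i)
    (h2 : i < c (n + 1)) (h3 : c m ≤ i) (h4 : i < c (m + 1)) : n = m := by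
  have h5 := hc.lt_iff_lt.1 (h1.trans_lt h4)
  have h6 := hc.lt_iff_lt.1 (h3.trans_lt h2)
  omega

theorem par_block_sup {K : ℕ} (a : ℕ → Fin (K + 1)) {c : ℕ → ℕ} (hc : StrictMono c)
    (h0 : c 0 = 0) :
    Par (fun n => (((Finset.Ico (c n) (c (n + 1))).sup a : Fin (K + 1)) : ℕ)) ↔
      Par fun i => (a i : ℕ) := by
  have hle : ∀ i n, c n ≤ i → i < c (n + 1) →
      (a i : ℕ) ≤ (((Finset.Ico (c n) (c (n + 1))).sup a : Fin (K + 1)) : ℕ) := fun i n h h' =>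
    Fin.le_def.1 (Finset.le_sup (f := a) (Finset.mem_Ico.2 ⟨h, h'⟩))
  have hex : ∀ n, ∃ i, c n ≤ i ∧ i < c (n + 1) ∧
      (((Finset.Ico (c n) (c (n + 1))).sup a : Fin (K + 1)) : ℕ) = a i := fun n => by
    obtain ⟨i, hi, e⟩ := Finset.exists_mem_eq_sup (Finset.Ico (c n) (c (n + 1)))
      (Finset.nonempty_Ico.2 (hc (Nat.lt_succ_self n))) a
    rw [Finset.mem_Ico] at hi
    exact ⟨i, hi.1, hi.2, by rw [e]⟩
  constructor
  · rintro ⟨m, hm, h1, N, h2⟩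
    refine ⟨m, hm, fun M => ?_, c N, fun i hi => ?_⟩
    · obtain ⟨n, hn, e⟩ := h1 M
      obtain ⟨i, hi, -, e'⟩ := hex n
      exact ⟨i, (hn.trans hc.le_apply).trans hi, e'.symm.trans e⟩
    · obtain ⟨n, hn, hn'⟩ := exists_block hc h0 i
      have := hc.lt_iff_lt.1 (lt_of_le_of_lt hi hn')
      exact (hle i n hn hn').trans (h2 n (by omega))
  · rintro ⟨m, hm, h1, N, h2⟩
    have h3 : ∀ n ≥ N, (((Finset.Ico (c n) (c (n + 1))).sup a : Fin (K + 1)) : ℕ) ≤ m :=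
        fun n hn => by
      obtain ⟨i, hi, -, e'⟩ := hex n
      rw [e']
      exact h2 i ((hn.trans hc.le_apply).trans hi)
    refine ⟨m, hm, fun M => ?_, N, h3⟩
    obtain ⟨i, hi, e⟩ := h1 (c (max M N))
    obtain ⟨n, hn, hn'⟩ := exists_block hc h0 i
    have := hc.lt_iff_lt.1 (lt_of_le_of_lt hi hn')
    refine ⟨n, by omega, le_antisymm (h3 n (by omega)) ?_⟩
    exact e.symm.trans_le (hle i n hn hn')

/-- All traces from `q₀` through a word of profiles satisfy the parity condition. -/
def GoodWord {Q : Type} {K : ℕ} (q₀ : Q) (w : ℕ → Profile Q K) : Prop :=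
  ∀ (τ : ℕ → Q) (a : ℕ → Fin (K + 1)), τ 0 = q₀ →
    (∀ i, (τ i, a i, τ (i + 1)) ∈ w i) → Par fun i => (a i : ℕ)

theorem contractible_goodWord {Q : Type} {K : ℕ} (q₀ : Q) :
    Contractible (GoodWord (K := K) q₀) := by
  intro w c hc h0
  constructor
  · intro hw τ' a' hτ' h
    choose τ a h1 h2 h3 h4 using fun n =>
      Profile.exists_run_of_mem_seg w (hc (Nat.lt_succ_self n)).le (h n)
    choose b hb hb' using exists_block hc h0
    have hbu : ∀ i n, c n ≤ i → i < c (n + 1) → b i = n := fun i n h5 h6 =>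
      block_unique hc (hb i) (hb' i) h5 h6
    have hnext : ∀ i, τ (b (i + 1)) (i + 1) = τ (b i) (i + 1) := by
      intro i
      by_cases hi : i + 1 < c (b i + 1)
      · rw [hbu (i + 1) (b i) (by have := hb i; omega) hi]
      · have e : i + 1 = c (b i + 1) := by have := hb' i; omega
        have e' : b (i + 1) = b i + 1 := hbu _ _ e.ge (by rw [e]; exact hc (Nat.lt_succ_self _))
        rw [e', e, h1, h2]
    have := hw (fun i => τ (b i) i) (fun i => a (b i) i) ?_ fun i => ?_
    · rw [← par_block_sup _ hc h0] at this
      convert this using 3 with n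
      rw [← h4 n]
      refine Finset.sup_congr rfl fun k hk => ?_
      rw [Finset.mem_Ico] at hk
      rw [hbu k n hk.1 hk.2]
    · have e : b 0 = 0 := hbu 0 0 h0.le (h0.symm.trans_lt (hc (Nat.lt_succ_self 0)))
      simp only [e]
      rw [← hτ', ← h1 0, h0]
    · simp only [hnext]
      exact h3 (b i) i (hb i) (hb' i)
  · intro hw τ a hτ h
    rw [← par_block_sup a hc h0]
    exact hw (fun n => τ (c n)) _ (by simp only [h0, hτ]) fun n =>
      Profile.mem_seg_of_run w τ a (hc (Nat.lt_succ_self n)).le fun k _ _ => h k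

/-! ### Properties definable in the one-step second-order language -/

/-- Renaming all variables, bound ones included. -/
def SOForm.map {T : SetFunctor} {F : LiftingFamily T} {W W' : Type} (f : W → W') :
    SOForm F W → SOForm F W'
  | .subset a b => .subset (f a) (f b)
  | .lift i v => .lift i (f ∘ v)
  | .neg φ => .neg (φ.map f)
  | .or φ ψ => .or (φ.map f) (ψ.map f)
  | .ex w φ => .ex (f w) (φ.map f)

theorem SOForm.sat_map {T : SetFunctor} {F : LiftingFamily T} {W W' : Type} {f : W → W'}
    (hf : Function.Injective f) {X : Type} {α : T.obj X} (φ : SOForm F W) (V : W' → Set X) :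
    (φ.map f).sat X α V ↔ φ.sat X α (V ∘ f) := by
  induction φ generalizing V with
  | subset a b => rfl
  | lift i v => rfl
  | neg φ ih => exact not_congr (ih V)
  | or φ ψ ih ih' => exact or_congr (ih V) (ih' V)
  | ex w φ ih =>
    refine exists_congr fun Z => (ih _).trans ?_
    have : updW V (f w) Z ∘ f = updW (V ∘ f) w Z := by
      funext w'
      simp [updW, hf.eq_iff]
    rw [this]

theorem SOForm.fv_map {T : SetFunctor} {F : LiftingFamily T} {W W' : Type} {f : W → W'}
    (hf : Function.Injective f) (φ : SOForm F W) : (φ.map f).fv = f '' φ.fv := by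
  induction φ with
  | subset a b => simp [SOForm.map, SOForm.fv, Set.image_pair]
  | lift i v => simp [SOForm.map, SOForm.fv, Set.range_comp]
  | neg φ ih => exact ih
  | or φ ψ ih ih' => simp [SOForm.map, SOForm.fv, ih, ih', Set.image_union]
  | ex w φ ih => simp [SOForm.map, SOForm.fv, ih, Set.image_sdiff hf]

/-- A property of one-step models over `A`. -/
abbrev OS (T : SetFunctor) (A : Type) : Type 1 := (X : Type) → T.obj X → (A → Set X) → Prop

/-- Definability of a one-step property by a sentence of `SO¹_Λ(A)`. -/
def Dfn {T : SetFunctor} (F : LiftingFamily T) {A : Type} (g : OS T A) : Prop :=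
  ∃ φ : SOForm F (A ⊕ ℕ), IsSentence φ ∧ ∀ X α V, φ.sat0 X α V ↔ g X α V

namespace Dfn

variable {T : SetFunctor} {F : LiftingFamily T} {A B : Type}

theorem congr {g g' : OS T A} (hg : Dfn F g) (h : ∀ X α V, g X α V ↔ g' X α V) : Dfn F g' :=
  let ⟨φ, h1, h2⟩ := hg
  ⟨φ, h1, fun X α V => (h2 X α V).trans (h X α V)⟩

theorem subset (a b : A) : Dfn F fun _ _ V => V a ⊆ V b :=
  ⟨.subset (.inl a) (.inl b), by simp [IsSentence, SOForm.fv], fun _ _ _ => Iff.rfl⟩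

theorem lift (i : F.ι) (v : Fin (F.ar i) → A) :
    Dfn F fun X α V => α ∈ (F.lf i).app X fun k => V (v k) :=
  ⟨.lift i fun k => .inl (v k), by simp [IsSentence, SOForm.fv], fun _ _ _ => Iff.rfl⟩

theorem neg {g : OS T A} (hg : Dfn F g) : Dfn F fun X α V => ¬ g X α V :=
  let ⟨φ, h1, h2⟩ := hg
  ⟨.neg φ, h1, fun X α V => not_congr (h2 X α V)⟩

theorem or {g g' : OS T A} (hg : Dfn F g) (hg' : Dfn F g') :
    Dfn F fun X α V => g X α V ∨ g' X α V :=
  let ⟨φ, h1, h2⟩ := hg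
  let ⟨ψ, h3, h4⟩ := hg'
  ⟨.or φ ψ, fun w hw => hw.elim (h1 w) (h3 w), fun X α V => or_congr (h2 X α V) (h4 X α V)⟩

theorem and {g g' : OS T A} (hg : Dfn F g) (hg' : Dfn F g') :
    Dfn F fun X α V => g X α V ∧ g' X α V :=
  (hg.neg.or hg'.neg).neg.congr fun X α V => by tauto

theorem imp {g g' : OS T A} (hg : Dfn F g) (hg' : Dfn F g') :
    Dfn F fun X α V => g X α V → g' X α V :=
  (hg.neg.or hg').congr fun X α V => by tauto

theorem map_inl {g : OS T A} (hg : Dfn F g) {f : A → B} (hf : Function.Injective f) :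
    Dfn F fun X α V => g X α (V ∘ f) := by
  obtain ⟨φ, h1, h2⟩ := hg
  have hf' : Function.Injective (Sum.map f (id : ℕ → ℕ)) := hf.sumMap Function.injective_id
  refine ⟨φ.map (Sum.map f id), fun w hw => ?_, fun X α V => ?_⟩
  · rw [SOForm.fv_map hf'] at hw
    obtain ⟨x, hx, rfl⟩ := hw
    obtain ⟨a, rfl⟩ := h1 x hx
    exact ⟨f a, rfl⟩
  · rw [SOForm.sat0, SOForm.sat_map hf', Sum.elim_comp_map]
    exact h2 X α (V ∘ f)

theorem ex {g : OS T (Option A)} (hg : Dfn F g) :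
    Dfn F fun X α V => ∃ Z : Set X, g X α fun o => o.elim Z V := by
  obtain ⟨φ, h1, h2⟩ := hg
  let f : Option A ⊕ ℕ → A ⊕ ℕ := Sum.elim (fun o => o.elim (.inr 0) .inl) fun k => .inr (k + 1)
  have hf : Function.Injective f := by
    rintro ((_ | a) | k) ((_ | b) | l) h <;> simp_all [f]
  refine ⟨.ex (.inr 0) (φ.map f), fun w hw => ?_, fun X α V => exists_congr fun Z => ?_⟩
  · obtain ⟨hw, hw'⟩ := hw
    rw [SOForm.fv_map hf] at hw
    obtain ⟨x, hx, rfl⟩ := hw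
    obtain ⟨_ | a, rfl⟩ := h1 x hx
    · exact absurd rfl hw'
    · exact ⟨a, rfl⟩
  · rw [SOForm.sat_map hf, ← h2, SOForm.sat0]
    have : updW (Sum.elim V fun _ => ∅) (Sum.inr 0) Z ∘ f =
        Sum.elim (fun o : Option A => o.elim Z V) fun _ => ∅ := by
      funext x
      rcases x with (_ | a) | k <;> simp [f, updW]
    rw [this]

theorem all {g : OS T (Option A)} (hg : Dfn F g) :
    Dfn F fun X α V => ∀ Z : Set X, g X α fun o => o.elim Z V :=
  hg.neg.ex.neg.congr fun X α V => by push Not; rfl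

theorem true : Dfn F fun _ _ (_ : A → Set _) => True :=
  (all (subset (A := Option A) none none)).congr fun _ _ _ => by simp

theorem const (P : Prop) : Dfn F fun _ _ (_ : A → Set _) => P := by
  by_cases h : P
  · exact true.congr fun _ _ _ => by simp [h]
  · exact true.neg.congr fun _ _ _ => by simp [h]

theorem forall_ {ι : Type} [Finite ι] {g : ι → OS T A} (hg : ∀ i, Dfn F (g i)) :
    Dfn F fun X α V => ∀ i, g i X α V := by
  revert g hg
  refine Finite.induction_empty_option (P := fun ι => ∀ {g : ι → OS T A},
    (∀ i, Dfn F (g i)) → Dfn F fun X α V => ∀ i, g i X α V) ?_ ?_ ?_ ι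
  · intro ι ι' e ih g hg
    exact (ih fun i => hg (e i)).congr fun X α V =>
      (e.forall_congr_left (p := fun i => g (e i) X α V)).trans (by simp)
  · intro g _
    exact true.congr fun X α V => by simp
  · intro ι _ ih g hg
    exact ((hg none).and (ih fun i => hg (some i))).congr fun X α V => by
      simp [Option.forall]

theorem exists_ {ι : Type} [Finite ι] {g : ι → OS T A} (hg : ∀ i, Dfn F (g i)) :
    Dfn F fun X α V => ∃ i, g i X α V :=
  (forall_ fun i => (hg i).neg).neg.congr fun X α V => by push Not; rfl

theorem exs [Finite B] {g : OS T (A ⊕ B)} (hg : Dfn F g) :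
    Dfn F fun X α V => ∃ W : B → Set X, g X α (Sum.elim V W) := by
  revert g hg
  refine Finite.induction_empty_option (P := fun B => ∀ {g : OS T (A ⊕ B)}, Dfn F g →
    Dfn F fun X α V => ∃ W : B → Set X, g X α (Sum.elim V W)) ?_ ?_ ?_ B
  · intro B B' e ih g hg
    have h := ih (hg.map_inl (f := Sum.map (id : A → A) e.symm)
      (Function.injective_id.sumMap e.symm.injective))
    refine h.congr fun X α V => ⟨fun ⟨W, hW⟩ => ⟨W ∘ e.symm, ?_⟩, fun ⟨W, hW⟩ => ⟨W ∘ e, ?_⟩⟩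
    · rwa [Sum.elim_comp_map] at hW
    · rw [Sum.elim_comp_map]
      simpa [Function.comp_assoc] using hW
  · intro g hg
    have h := hg.map_inl (f := Sum.elim (id : A → A) PEmpty.elim)
      (by rintro (a | ⟨⟨⟩⟩) (b | ⟨⟨⟩⟩) h; simp_all)
    refine h.congr fun X α V => ?_
    have : ∀ W : PEmpty → Set X, V ∘ Sum.elim id PEmpty.elim = Sum.elim V W := fun W => by
      funext x
      rcases x with a | a
      · rfl
      · exact a.elim
    exact ⟨fun h => ⟨PEmpty.elim, this _ ▸ h⟩, fun ⟨W, h⟩ => this W ▸ h⟩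
  · intro B _ ih g hg
    have h := ih (Dfn.ex (A := A ⊕ B) (hg.map_inl
      (f := Sum.elim (fun a => some (.inl a)) fun o => o.elim none fun b => some (.inr b))
      (by rintro (a | _ | a) (b | _ | b) h <;> simp_all)))
    refine h.congr fun X α V => ?_
    have : ∀ (W : B → Set X) Z, (fun o : Option (A ⊕ B) => o.elim Z (Sum.elim V W)) ∘
        (Sum.elim (fun a => some (.inl a)) fun o : Option B =>
          o.elim none fun b => some (.inr b)) =
        Sum.elim V fun o => o.elim Z W := fun W Z => by
      funext x
      rcases x with a | _ | b <;> rfl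
    simp only [this]
    refine ⟨fun ⟨W, Z, h⟩ => ⟨_, h⟩, fun ⟨W, h⟩ => ⟨fun b => W (some b), W none, ?_⟩⟩
    convert h using 2
    funext o
    cases o <;> rfl

theorem empty (a : A) : Dfn F fun _ _ V => V a = ∅ :=
  (all (subset (A := Option A) (some a) none)).congr fun X α V => by
    simp only [Option.elim]
    exact ⟨fun h => Set.subset_empty_iff.1 (h ∅), fun h Z => by rw [h]; exact Set.empty_subset _⟩

theorem disjoint (a b : A) : Dfn F fun _ _ V => Disjoint (V a) (V b) :=
  (all (((subset (A := Option A) none (some a)).and (subset none (some b))).imp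
    (empty none))).congr fun X α V => by
    simp only [Option.elim]
    refine ⟨fun h => Set.disjoint_iff_inter_eq_empty.2 (h _ ⟨?_, ?_⟩), fun h Z hZ => ?_⟩
    · exact Set.inter_subset_left
    · exact Set.inter_subset_right
    · exact Set.subset_empty_iff.1 (h hZ.1 hZ.2)

/-- Any condition on the pointwise types of the valuation is definable. -/
theorem forall_type [Finite A] (P : Set A → Prop) :
    Dfn F fun _ _ V => ∀ x, P {a | x ∈ V a} := by
  have h : ∀ ρ : Set A, Dfn F fun X (_ : T.obj X) V => ∃ x : X, {a | x ∈ V a} = ρ := fun ρ => by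
    have h1 : Dfn F fun X (_ : T.obj X) (V : Option A → Set X) => ∀ a, if a ∈ ρ then
        V none ⊆ V (some a) else Disjoint (V none) (V (some a)) := forall_ fun a => by
      split_ifs
      · exact subset _ _
      · exact disjoint _ _
    refine (((empty (A := Option A) none).neg.and h1).ex).congr fun X α V => ⟨?_, ?_⟩
    · rintro ⟨Z, h2, h3⟩
      obtain ⟨x, hx⟩ := Set.nonempty_iff_ne_empty.2 h2
      refine ⟨x, Set.ext fun a => ?_⟩
      have := h3 a
      split_ifs at this with ha
      · exact ⟨fun _ => ha, fun _ => this hx⟩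
      · exact ⟨fun h => absurd h (Set.disjoint_left.1 this hx), fun h => absurd h ha⟩
    · rintro ⟨x, rfl⟩
      refine ⟨{x}, Set.singleton_ne_empty x, fun a => ?_⟩
      split_ifs with ha
      · exact Set.singleton_subset_iff.2 ha
      · exact Set.disjoint_singleton_left.2 ha
  refine (forall_ fun ρ : Set A => (h ρ).imp (const (P ρ))).congr fun X α V => ?_
  exact ⟨fun h x => h _ ⟨x, rfl⟩, by rintro h _ ⟨x, rfl⟩; exact h x⟩

end Dfn

/-! ### Uniform strategies and local unfolding of parity games -/

section Games

variable {Q S : Type} {Φ : (Q → Set S) → Q → Set S} {Ω : Q → ℕ}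

theorem Wins.next {f : Q → S → Q → Set S} {D : Q → Set S} {q : Q} {s : S}
    (hf : ∀ q', ∀ s' ∈ D q', s' ∈ Φ (f q' s') q' ∧ FamLe (f q' s') D) (hD : s ∈ D q)
    (hp : ∀ (a : ℕ → Q) (b : ℕ → S), a 0 = q → b 0 = s →
      (∀ i, b (i + 1) ∈ f (a i) (b i) (a (i + 1))) → Par fun i => Ω (a i))
    {q' : Q} {s' : S} (h : s' ∈ f q s q') : Wins Φ Ω q' s' := by
  refine ⟨f, D, (hf q s hD).2 q' h, hf, fun a b ha hb hab => ?_⟩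
  refine (par_shift_iff 1).2 (hp (fun i => Nat.casesOn i q a) (fun i => Nat.casesOn i s b) rfl rfl
    fun i => ?_)
  cases i with
  | zero => simpa [ha, hb] using h
  | succ i => exact hab i

theorem wins_uniform [Finite Q] (hΦ : OpMono Φ) : ∃ f : Q → S → Q → Set S,
    (∀ q s, Wins Φ Ω q s → s ∈ Φ (f q s) q ∧ FamLe (f q s) fun q => {s | Wins Φ Ω q s}) ∧
      ∀ (a : ℕ → Q) (b : ℕ → S), Wins Φ Ω (a 0) (b 0) →
        (∀ i, b (i + 1) ∈ f (a i) (b i) (a (i + 1))) → Par fun i => Ω (a i) := by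
  rcases isEmpty_or_nonempty Q with hQ | hQ
  · exact ⟨fun q => isEmptyElim q, fun q => isEmptyElim q, fun a => isEmptyElim (a 0)⟩
  obtain ⟨E⟩ := exists_enum Q Ω
  obtain ⟨f, h1, h2⟩ := sol_strategy E hΦ E.n le_rfl fun _ => ∅
  have e : (sol (fun k => Even (Ω (E.en k))) E.en Φ E.n fun _ => ∅) =
      fun q => {s | Wins Φ Ω q s} := by
    funext q
    exact Set.ext fun s => (wins_iff_sol E hΦ _ q s).symm
  rw [e] at h1 h2
  exact ⟨f, fun q s h => h1 q (E.idx_lt q) s h, fun a b h => h2 a b (fun i => E.idx_lt _) h⟩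

theorem wins_fix [Finite Q] (hΦ : OpMono Φ) (q : Q) (s : S) :
    Wins Φ Ω q s ↔ s ∈ Φ (fun q => {s | Wins Φ Ω q s}) q := by
  constructor
  · rintro ⟨f, D, hD, hf, hp⟩
    have hle : FamLe (f q s) fun q => {s | Wins Φ Ω q s} := fun q' s' h => Wins.next hf hD hp h
    exact hΦ _ _ hle q (hf q s hD).1
  · intro h
    by_contra hn
    obtain ⟨f, h1, h2⟩ := wins_uniform (Ω := Ω) hΦ
    refine hn ⟨fun q' s' => if q' = q ∧ s' = s then fun q => {s | Wins Φ Ω q s} else f q' s',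
      fun q' => {s' | (q' = q ∧ s' = s) ∨ Wins Φ Ω q' s'}, Or.inl ⟨rfl, rfl⟩, ?_, ?_⟩
    · intro q' s' hs'
      beta_reduce
      split_ifs with hq
      · obtain ⟨rfl, rfl⟩ := hq
        exact ⟨h, fun _ _ => Or.inr⟩
      · have := h1 q' s' (hs'.resolve_left hq)
        exact ⟨this.1, fun q'' s'' h'' => Or.inr (this.2 q'' h'')⟩
    · rintro a b rfl rfl hab
      have hne : ∀ i, Wins Φ Ω (a i) (b i) → ¬ (a i = a 0 ∧ b i = b 0) := by
        rintro i hi ⟨e, e'⟩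
        exact hn (e ▸ e' ▸ hi)
      have hw : ∀ i, Wins Φ Ω (a (i + 1)) (b (i + 1)) := by
        intro i
        induction i with
        | zero => simpa using hab 0
        | succ i ih =>
          have := hab (i + 1)
          beta_reduce at this
          rw [if_neg (hne _ ih)] at this
          exact (h1 _ _ ih).2 _ this
      refine (par_shift_iff 1).1 (h2 (fun i => a (i + 1)) (fun i => b (i + 1)) (hw 0) fun i => ?_)
      have := hab (i + 1)
      beta_reduce at this
      rwa [if_neg (hne _ (hw i))] at this

theorem wins_embed {Q₁ : Type} {Φ₁ : (Q₁ → Set S) → Q₁ → Set S} {Ω₁ : Q₁ → ℕ} {j : Q₁ → Q}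
    (hj : Function.Injective j) (hΩ : ∀ q, Ω (j q) = Ω₁ q)
    (h : ∀ e q, Φ e (j q) = Φ₁ (fun q' => e (j q')) q) (q : Q₁) (s : S) :
    Wins Φ Ω (j q) s ↔ Wins Φ₁ Ω₁ q s := by
  constructor
  · rintro ⟨f, D, hD, hf, hp⟩
    refine ⟨fun q s q' => f (j q) s (j q'), fun q => D (j q), hD, fun q' s' hs' => ?_, ?_⟩
    · have := hf (j q') s' hs'
      rw [h] at this
      exact ⟨this.1, fun q'' => this.2 (j q'')⟩
    · rintro a b rfl rfl hab
      have := hp (fun i => j (a i)) b rfl rfl hab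
      simpa only [hΩ] using this
  · rintro ⟨f, D, hD, hf, hp⟩
    have hfj : ∀ q s q', {s' : S | ∃ q₁ q₂, j q₁ = j q ∧ j q₂ = j q' ∧ s' ∈ f q₁ s q₂} =
        f q s q' := by
      intro q s q'
      ext s'
      constructor
      · rintro ⟨q₁, q₂, h1, h2, h3⟩
        rwa [hj h1, hj h2] at h3
      · exact fun h3 => ⟨q, q', rfl, rfl, h3⟩
    refine ⟨fun q s q' => {s' | ∃ q₁ q₂, j q₁ = q ∧ j q₂ = q' ∧ s' ∈ f q₁ s q₂},
      fun q => {s | ∃ q₁, j q₁ = q ∧ s ∈ D q₁}, ⟨q, rfl, hD⟩, ?_, ?_⟩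
    · rintro _ s' ⟨q', rfl, hs'⟩
      rw [h]
      simp only [hfj]
      refine ⟨(hf q' s' hs').1, ?_⟩
      rintro q'' s'' ⟨q₁, q₂, h1, rfl, h3⟩
      rw [hj h1] at h3
      exact ⟨q₂, rfl, (hf q' s' hs').2 q₂ h3⟩
    · intro a b ha hb hab
      have hex : ∀ i, ∃ q₁, j q₁ = a i := by
        intro i
        cases i with
        | zero => exact ⟨q, ha.symm⟩
        | succ i =>
          obtain ⟨q₁, q₂, -, h2, -⟩ := hab i
          exact ⟨q₂, h2⟩
      choose a' ha' using hex
      have := hp a' b (hj ((ha' 0).trans ha)) hb fun i => by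
        have := hab i
        rw [← ha' i, ← ha' (i + 1)] at this
        rwa [← hfj]
      simpa only [← hΩ, ha'] using this

end Games

/-! ### Tree-shaped coalgebras and parity automata on them -/

/-- A tree-shaped coalgebra, presented by the sets of children of its nodes. -/
structure Tr (T : SetFunctor) where
  N : Type
  root : N
  Ch : N → Type
  α : (t : N) → T.obj (Ch t)
  child : (t : N) → Ch t → N
  depth : N → ℕ
  depth_root : depth root = 0
  depth_child : ∀ t x, depth (child t x) = depth t + 1
  cases : ∀ t, t = root ∨ ∃ u x, child u x = t
  inj : ∀ {t t' x x'}, child t x = child t' x' →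
    (⟨t, x⟩ : Σ t, Ch t) = ⟨t', x'⟩

namespace Tr

variable {T : SetFunctor} (R : Tr T)

/-- The coalgebra structure of a tree. -/
def σ (t : R.N) : T.obj R.N := T.map (R.child t) (R.α t)

theorem child_ne_root (t : R.N) (x : R.Ch t) : R.child t x ≠ R.root := fun h => by
  have h1 := R.depth_child t x
  rw [h, R.depth_root] at h1
  omega

theorem induction {P : R.N → Prop} (h0 : P R.root) (h : ∀ t x, P t → P (R.child t x)) (t : R.N) :
    P t := by
  induction hn : R.depth t generalizing t with
  | zero =>
    rcases R.cases t with rfl | ⟨u, x, rfl⟩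
    · exact h0
    · simp [R.depth_child] at hn
  | succ n ih =>
    rcases R.cases t with rfl | ⟨u, x, rfl⟩
    · exact h0
    · exact h u x (ih u (by simpa [R.depth_child] using hn))

theorem exists_rec {M : Type} (m₀ : M) (f : M → (t : R.N) → R.Ch t → M) :
    ∃ g : R.N → M, g R.root = m₀ ∧ ∀ t x, g (R.child t x) = f (g t) t x := by
  let G : ℕ → R.N → M := fun n => Nat.rec (fun _ => m₀) (fun _ g t =>
    if h : ∃ y : Σ u, R.Ch u, R.child y.1 y.2 = t then
      f (g h.choose.1) h.choose.1 h.choose.2 else m₀) n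
  refine ⟨fun t => G (R.depth t) t, by simp only [R.depth_root]; rfl, fun t x => ?_⟩
  have h : ∃ y : Σ u, R.Ch u, R.child y.1 y.2 = R.child t x := ⟨⟨t, x⟩, rfl⟩
  simp only [R.depth_child]
  change (if h : ∃ y : Σ u, R.Ch u, R.child y.1 y.2 = R.child t x then
    f (G (R.depth t) h.choose.1) h.choose.1 h.choose.2 else m₀) = _
  rw [dif_pos h]
  have : h.choose = ⟨t, x⟩ := R.inj h.choose_spec
  rw [this]

end Tr

/-- Alternating parity automata whose transition conditions are monotone and definable in the
one-step second-order language. The letters are sets of propositional variables. -/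
structure Aut {T : SetFunctor} (F : LiftingFamily T) where
  Q : Type
  fin : Finite Q
  init : Q
  Ω : Q → ℕ
  Δ : Q → Set ℕ → OS T Q
  mono : ∀ {q c X α V V'}, (∀ q', V q' ⊆ V' q') → Δ q c X α V → Δ q c X α V'
  dfn : ∀ q c, Dfn F (Δ q c)
  bd : ℕ
  supp : ∀ {q c c'}, (∀ p < bd, p ∈ c ↔ p ∈ c') → Δ q c = Δ q c'

attribute [instance] Aut.fin

namespace Aut

variable {T : SetFunctor} {F : LiftingFamily T}

/-- The acceptance game of an automaton on a tree. -/
def step (A : Aut F) (R : Tr T) (V : ℕ → Set R.N) (Z : A.Q → Set R.N) (q : A.Q) : Set R.N :=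
  {t | A.Δ q {p | t ∈ V p} (R.Ch t) (R.α t) fun q' => R.child t ⁻¹' Z q'}

theorem step_mono (A : Aut F) (R : Tr T) (V : ℕ → Set R.N) : OpMono (A.step R V) :=
  fun _ _ h _ _ ht => A.mono (fun q' => Set.preimage_mono (h q')) ht

/-- Acceptance of a tree. -/
def Acc (A : Aut F) (R : Tr T) (V : ℕ → Set R.N) : Prop :=
  Wins (A.step R V) A.Ω A.init R.root

/-- The complement automaton. -/
def compl (A : Aut F) : Aut F where
  Q := A.Q
  fin := A.fin
  init := A.init
  Ω q := A.Ω q + 1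
  Δ q c X α V := ¬ A.Δ q c X α fun q' => (V q')ᶜ
  mono h := mt (A.mono fun q' => Set.compl_subset_compl.2 (h q'))
  dfn q c := by
    have h := ((Dfn.forall_type (F := F) fun ρ : Set (A.Q ⊕ A.Q) =>
      ∀ q, .inr q ∈ ρ ↔ .inl q ∉ ρ).and
      ((A.dfn q c).map_inl (Sum.inr_injective (α := A.Q))).neg).exs
    refine h.congr fun X α V => ⟨?_, fun h => ⟨fun q' => (V q')ᶜ, by simp, h⟩⟩
    rintro ⟨W, h1, h2⟩
    have : W = fun q' => (V q')ᶜ := by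
      funext q'
      exact Set.ext fun x => h1 x q'
    rwa [← this]
  bd := A.bd
  supp h := by simp only [A.supp h]

theorem acc_compl (A : Aut F) (R : Tr T) (V : ℕ → Set R.N) : A.compl.Acc R V ↔ ¬ A.Acc R V :=
  (not_wins_iff (A.step_mono R V) _ _).symm

/-- The union of two automata. -/
def union (A B : Aut F) : Aut F where
  Q := Option (A.Q ⊕ B.Q)
  fin := inferInstance
  init := none
  Ω := fun q => q.elim 0 (Sum.elim A.Ω B.Ω)
  Δ := fun q c X α V => q.elim
    (A.Δ A.init c X α (V ∘ some ∘ .inl) ∨ B.Δ B.init c X α (V ∘ some ∘ .inr))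
    (Sum.elim (fun q => A.Δ q c X α (V ∘ some ∘ .inl)) fun q => B.Δ q c X α (V ∘ some ∘ .inr))
  mono := by
    rintro (_ | q | q) c X α V V' h
    · exact Or.imp (A.mono fun q' => h _) (B.mono fun q' => h _)
    · exact A.mono fun q' => h _
    · exact B.mono fun q' => h _
  dfn := by
    have h1 : ∀ q c, Dfn F fun X α (V : Option (A.Q ⊕ B.Q) → Set X) =>
        A.Δ q c X α (V ∘ some ∘ .inl) := fun q c =>
      (A.dfn q c).map_inl ((Option.some_injective _).comp Sum.inl_injective)
    have h2 : ∀ q c, Dfn F fun X α (V : Option (A.Q ⊕ B.Q) → Set X) =>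
        B.Δ q c X α (V ∘ some ∘ .inr) := fun q c =>
      (B.dfn q c).map_inl ((Option.some_injective _).comp Sum.inr_injective)
    rintro (_ | q | q) c
    · exact (h1 _ c).or (h2 _ c)
    · exact h1 q c
    · exact h2 q c
  bd := max A.bd B.bd
  supp := by
    intro q c c' h
    have h1 : ∀ q, A.Δ q c = A.Δ q c' := fun q => A.supp fun p hp => h p (lt_max_of_lt_left hp)
    have h2 : ∀ q, B.Δ q c = B.Δ q c' := fun q => B.supp fun p hp => h p (lt_max_of_lt_right hp)
    simp only [h1, h2]

theorem acc_union (A B : Aut F) (R : Tr T) (V : ℕ → Set R.N) :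
    (A.union B).Acc R V ↔ A.Acc R V ∨ B.Acc R V := by
  have hA : ∀ q t, Wins ((A.union B).step R V) (A.union B).Ω (some (.inl q)) t ↔
      Wins (A.step R V) A.Ω q t :=
    wins_embed ((Option.some_injective _).comp Sum.inl_injective) (fun _ => rfl) fun _ _ => rfl
  have hB : ∀ q t, Wins ((A.union B).step R V) (A.union B).Ω (some (.inr q)) t ↔
      Wins (B.step R V) B.Ω q t :=
    wins_embed ((Option.some_injective _).comp Sum.inr_injective) (fun _ => rfl) fun _ _ => rfl
  unfold Acc
  rw [wins_fix ((A.union B).step_mono R V), wins_fix (A.step_mono R V),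
    wins_fix (B.step_mono R V)]
  simp only [← hA, ← hB]
  exact Iff.rfl

/-- An automaton checking a condition on every node, its children, and whether it is the root. -/
def safety (n : ℕ) (θ : Prop → Set ℕ → OS T (Fin n))
    (mono : ∀ {r c X α V V'}, (∀ p, V p ⊆ V' p) → θ r c X α V → θ r c X α V')
    (dfn : ∀ r c, Dfn F (θ r c))
    (supp : ∀ {r c c'}, (∀ p < n, p ∈ c ↔ p ∈ c') → θ r c = θ r c') : Aut F where
  Q := Prop ⊕ Fin n
  fin := inferInstance
  init := .inl True
  Ω _ := 0
  Δ q c X α V := q.elim (fun r => θ r c X α (V ∘ .inr) ∧ ∀ x, x ∈ V (.inl False)) fun p => ↑p ∈ c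
  mono := by
    rintro (r | p) c X α V V' h
    · exact fun ⟨h1, h2⟩ => ⟨mono (fun p => h _) h1, fun x => h _ (h2 x)⟩
    · exact id
  dfn := by
    rintro (r | p) c
    · exact ((dfn r c).map_inl Sum.inr_injective).and
        (Dfn.forall_type (F := F) fun ρ : Set (Prop ⊕ Fin n) => .inl False ∈ ρ)
    · exact Dfn.const _
  bd := n
  supp := by
    rintro (r | p) c c' h
    · simp only [Sum.elim_inl, supp h]
    · funext X α V
      exact propext (h p p.2)

theorem acc_safety {n : ℕ} {θ : Prop → Set ℕ → OS T (Fin n)} {mono dfn supp}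
    (R : Tr T) (V : ℕ → Set R.N) :
    (safety (F := F) n θ mono dfn supp).Acc R V ↔ ∀ t : R.N, θ (t = R.root) {p | t ∈ V p} (R.Ch t)
      (R.α t) fun p => R.child t ⁻¹' V p := by
  constructor
  · rintro ⟨f, D, hD, hf, -⟩
    have hroot : ∀ t, t ∈ D (.inl (t = R.root)) := by
      refine R.induction (by rw [eq_true rfl]; exact hD) fun t x ht => ?_
      have h := (hf _ t ht).1.2 x
      rw [eq_false (R.child_ne_root t x)]
      exact (hf _ t ht).2 _ h
    intro t
    refine mono (fun p x hx => ?_) (hf _ t (hroot t)).1.1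
    exact (hf (.inr p) _ ((hf _ t (hroot t)).2 _ hx)).1
  · intro h
    refine ⟨fun _ _ => Sum.elim (fun r => {t | (t = R.root) = r}) fun p => V p,
      Sum.elim (fun r => {t | (t = R.root) = r}) fun p => V p, by simp [safety], ?_, ?_⟩
    · rintro (r | p) t ht
      · obtain rfl : (t = R.root) = r := ht
        exact ⟨⟨h t, fun x => eq_false (R.child_ne_root t x)⟩, fun _ => subset_rfl⟩
      · exact ⟨ht, fun _ => subset_rfl⟩
    · intro a b _ _ _
      exact ⟨0, Even.zero, fun N => ⟨N, le_rfl, rfl⟩, 0, fun _ _ => le_rfl⟩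

end Aut

/-! ### Projection -/

namespace Aut

variable {T : SetFunctor} {F : LiftingFamily T} (A : Aut F)

theorem exists_prio_bound : ∃ K, ∀ q, A.Ω q < K + 1 := by
  obtain ⟨K, hK⟩ := (Set.finite_range A.Ω).bddAbove
  exact ⟨K, fun q => Nat.lt_succ_of_le (hK ⟨q, rfl⟩)⟩

/-- A bound on the priorities. -/
noncomputable def K : ℕ := A.exists_prio_bound.choose

/-- The profile of moves out of the states in `Y` along the pairs in `ρ`. -/
def letter (Y : Set A.Q) (ρ : Set (A.Q × A.Q)) : Profile A.Q A.K :=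
  {e : A.Q × Fin (A.K + 1) × A.Q | e.1 ∈ Y ∧ (e.1, e.2.2) ∈ ρ ∧ (e.2.1 : ℕ) = A.Ω e.1}

theorem mem_letter {Y : Set A.Q} {ρ : Set (A.Q × A.Q)} {q q' : A.Q} {v : Fin (A.K + 1)} :
    (q, v, q') ∈ A.letter Y ρ ↔ q ∈ Y ∧ (q, q') ∈ ρ ∧ (v : ℕ) = A.Ω q := Iff.rfl

theorem exists_prio (q : A.Q) : ∃ v : Fin (A.K + 1), (v : ℕ) = A.Ω q :=
  ⟨⟨A.Ω q, A.exists_prio_bound.choose_spec q⟩, rfl⟩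

/-- The transition of the powerset automaton paired with a deterministic automaton `δ`. -/
def next {M : Type} (δ : M → Profile A.Q A.K → M) (s : M × Set A.Q) (ρ : Set (A.Q × A.Q)) :
    M × Set A.Q :=
  (δ s.1 (A.letter s.2 ρ), {q' | ∃ q ∈ s.2, (q, q') ∈ ρ})

/-- The letter `c`, with the truth value of `p` replaced by `b`. -/
def recolor (p : ℕ) (b : Prop) (c : Set ℕ) : Set ℕ := {i | if i = p then b else i ∈ c}

theorem recolor_updW {N : Type} (V : ℕ → Set N) (p : ℕ) (Z : Set N) (t : N) :
    {i | t ∈ updW V p Z i} = recolor p (t ∈ Z) {i | t ∈ V i} := by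
  ext i
  simp only [Set.mem_ofPred_eq, recolor, updW]
  split_ifs <;> rfl

/-- The projection automaton, built on a deterministic automaton for the good words. -/
def proj (p : ℕ) {M : Type} [Finite M] (m₀ : M) (δ : M → Profile A.Q A.K → M) (Ω : M → ℕ) :
    Aut F where
  Q := M × Set A.Q
  fin := inferInstance
  init := (m₀, {A.init})
  Ω s := Ω s.1
  Δ s c X α V := ∃ (b : Prop) (W : A.Q × A.Q → Set X),
    (∀ q ∈ s.2, A.Δ q (recolor p b c) X α fun q' => W (q, q')) ∧
      ∀ x, x ∈ V (A.next δ s {e | x ∈ W e})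
  mono h := fun ⟨b, W, h1, h2⟩ => ⟨b, W, h1, fun x => h _ (h2 x)⟩
  dfn s c := by
    refine Dfn.exists_ fun b => (Dfn.exs (((Dfn.forall_ fun q => (Dfn.const (q ∈ s.2)).imp
      ((A.dfn q (recolor p b c)).map_inl (B := (M × Set A.Q) ⊕ (A.Q × A.Q))
        (f := fun q' => .inr (q, q')) fun _ _ h => by simpa using h)).and
      (Dfn.forall_type fun ρ => .inl (A.next δ s {e | .inr e ∈ ρ}) ∈ ρ)))).congr ?_
    exact fun X α V => Iff.rfl
  bd := A.bd
  supp := by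
    intro s c c' h
    have : ∀ q b, A.Δ q (recolor p b c) = A.Δ q (recolor p b c') := fun q b =>
      A.supp fun i hi => by
        simp only [recolor, Set.mem_ofPred_eq]
        split_ifs
        · rfl
        · exact h i hi
    simp only [this]

theorem exists_proj (p : ℕ) : ∃ B : Aut F, ∀ (R : Tr T) (V : ℕ → Set R.N),
    B.Acc R V ↔ ∃ Z, A.Acc R (updW V p Z) := by
  obtain ⟨M, _, m₀, δ, Ω, hdet⟩ := exists_det (contractible_goodWord (K := A.K) A.init)
  refine ⟨A.proj p m₀ δ Ω, fun R V => ⟨?_, ?_⟩⟩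
  · rintro ⟨(f : M × Set A.Q → R.N → M × Set A.Q → Set R.N), (D : M × Set A.Q → Set R.N),
      hD, hf, hp⟩
    have hΔ : ∀ (s : M × Set A.Q) t, t ∈ D s → ∃ (b : Prop) (W : A.Q × A.Q → Set (R.Ch t)),
        (∀ q ∈ s.2, A.Δ q (recolor p b {i | t ∈ V i}) _ (R.α t) fun q' => W (q, q')) ∧
          ∀ x, R.child t x ∈ f s t (A.next δ s {e | x ∈ W e}) := fun s t ht => (hf s t ht).1
    choose! b W hW hWf using hΔ
    obtain ⟨st, hst₀, hst⟩ := R.exists_rec ((m₀, {A.init}) : M × Set A.Q)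
      fun s t x => A.next δ s {e | x ∈ W s t e}
    have hstf : ∀ t x, t ∈ D (st t) → R.child t x ∈ f (st t) t (st (R.child t x)) :=
      fun t x ht => by
        rw [hst]
        exact hWf _ t ht x
    have hstD : ∀ t, t ∈ D (st t) := by
      refine R.induction (by rw [hst₀]; exact hD) fun t x ht => ?_
      exact (hf _ t ht).2 _ (hstf t x ht)
    refine ⟨{t | b (st t) t}, fun q t q' => {c | ∃ x, R.child t x = c ∧ x ∈ W (st t) t (q, q')},
      fun q => {t | q ∈ (st t).2}, by simp [hst₀], ?_, ?_⟩
    · intro q t ht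
      constructor
      · have := hW _ t (hstD t) q ht
        simp only [step, Set.mem_ofPred_eq, recolor_updW]
        exact A.mono (fun q' x hx => ⟨x, rfl, hx⟩) this
      · rintro q' c ⟨x, rfl, hx⟩
        simp only [Set.mem_ofPred_eq, hst, next]
        exact ⟨q, ht, hx⟩
    · intro a c ha hc hac
      choose x hx hxW using hac
      have hmem : ∀ i, a i ∈ (st (c i)).2 := by
        intro i
        induction i with
        | zero => simp [hc, hst₀, ha]
        | succ i ih =>
          rw [← hx, hst]
          exact ⟨a i, ih, hxW i⟩
      have hpar := hp (fun i => st (c i)) c (by simp only [hc, hst₀]; rfl) hc fun i => by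
        rw [← hx i]
        exact hstf _ _ (hstD _)
      have hgood := (hdet (fun i => A.letter (st (c i)).2 {e | x i ∈ W (st (c i)) (c i) e})
        (fun i => (st (c i)).1) (by simp only [hc, hst₀]) fun i => by
          rw [← hx i, hst]
          rfl).2 hpar
      choose v hv using A.exists_prio
      simpa only [hv] using hgood a (fun i => v (a i)) ha fun i =>
        A.mem_letter.2 ⟨hmem i, hxW i, hv _⟩
  · rintro ⟨Z, f, D, hD, hf, hp⟩
    refine ⟨fun s t s' => {c | ∃ x, R.child t x = c ∧
        s' = A.next δ s {e | R.child t x ∈ f e.1 t e.2}},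
      fun s => {t | ∀ q ∈ s.2, t ∈ D q}, ?_, ?_, ?_⟩
    · rintro q rfl
      exact hD
    · intro s t ht
      refine ⟨⟨t ∈ Z, fun e => R.child t ⁻¹' f e.1 t e.2, fun q hq => ?_,
        fun x => ⟨x, rfl, rfl⟩⟩, ?_⟩
      · rw [← recolor_updW]
        exact (hf q t (ht q hq)).1
      · rintro s' c ⟨x, rfl, rfl⟩ q' ⟨q, hq, hqq'⟩
        exact (hf q t (ht q hq)).2 q' hqq'
    · intro a c ha hc hac
      choose x hx hxa using hac
      refine (hdet (fun i => A.letter (a i).2 {e | c (i + 1) ∈ f e.1 (c i) e.2})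
        (fun i => (a i).1) (by simp only [ha]; rfl) fun i => ?_).1 ?_
      · simp only [hxa i, hx i]
        rfl
      · intro τ v hτ hτv
        have h : ∀ i, (v i : ℕ) = A.Ω (τ i) := fun i => (A.mem_letter.1 (hτv i)).2.2
        simp only [h]
        exact hp τ c hτ hc fun i => (A.mem_letter.1 (hτv i)).2.1

end Aut

/-- Every formula of `MSO_Λ` is equivalent on tree-shaped models to a parity automaton. -/
theorem MSOForm.exists_aut {T : SetFunctor} {F : LiftingFamily T} (φ : MSOForm F) :
    ∃ A : Aut F, ∀ (R : Tr T) (V : ℕ → Set R.N), φ.sat R.σ V R.root ↔ A.Acc R V := by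
  induction φ with
  | bot =>
    refine ⟨.safety 0 (fun _ _ _ _ _ => False) (fun _ => id) (fun _ _ => Dfn.const _)
      fun _ => rfl, fun R V => ?_⟩
    rw [Aut.acc_safety]
    exact ⟨False.elim, fun h => h R.root⟩
  | sr p =>
    refine ⟨.safety (p + 1) (fun r c _ _ _ => p ∈ c ↔ r) (fun _ => id) (fun _ _ => Dfn.const _)
      (fun h => by simp only [h p (Nat.lt_succ_self p)]), fun R V => ?_⟩
    rw [Aut.acc_safety]
    exact Set.ext_iff
  | subset p q =>
    refine ⟨.safety (p + q + 1) (fun _ c _ _ _ => p ∈ c → q ∈ c) (fun _ => id)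
      (fun _ _ => Dfn.const _) (fun h => by simp only [h p (by omega), h q (by omega)]),
      fun R V => ?_⟩
    rw [Aut.acc_safety]
    exact Iff.rfl
  | lift i p qs =>
    obtain ⟨n, hn⟩ := (Set.finite_range qs).bddAbove
    have hn' : ∀ k, qs k < n + p + 1 := fun k => by
      have := hn ⟨k, rfl⟩
      omega
    refine ⟨.safety (n + p + 1)
      (fun _ c X α V => p ∈ c → α ∈ (F.lf i).app X fun k => V ⟨qs k, hn' k⟩)
      (fun h h' hc => F.mono i _ _ _ (fun k => h _) (h' hc))
      (fun _ c => (Dfn.const _).imp (Dfn.lift _ _))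
      (fun h => by simp only [h p (by omega)]), fun R V => ?_⟩
    rw [Aut.acc_safety]
    refine forall_congr' fun t => imp_congr_right fun _ => ?_
    rw [(F.lf i).natural]
    exact Iff.rfl
  | or φ ψ ih ih' =>
    obtain ⟨A, hA⟩ := ih
    obtain ⟨B, hB⟩ := ih'
    exact ⟨A.union B, fun R V => by rw [Aut.acc_union, ← hA, ← hB]; rfl⟩
  | neg φ ih =>
    obtain ⟨A, hA⟩ := ih
    exact ⟨A.compl, fun R V => by rw [Aut.acc_compl, ← hA]; rfl⟩
  | ex p φ ih =>
    obtain ⟨A, hA⟩ := ih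
    obtain ⟨B, hB⟩ := A.exists_proj p
    exact ⟨B, fun R V => by simp only [hB, ← hA]; rfl⟩

/-! ### Invariance of the μ-calculus -/

namespace MuForm

variable {T : SetFunctor} {F : LiftingFamily T}

theorem sem_mu {S : Type} (σ : S → T.obj S) (p : ℕ) (φ : MuForm F) (V : ℕ → Set S) :
    (mu p φ).sem σ V = fp False fun Z => φ.sem σ (updW V p Z) := (if_neg id).symm

theorem sem_nu {S : Type} (σ : S → T.obj S) (p : ℕ) (φ : MuForm F) (V : ℕ → Set S) :
    (nu p φ).sem σ V = fp True fun Z => φ.sem σ (updW V p Z) := (if_pos trivial).symm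

theorem updW_comm {W X : Type} (V : W → Set X) {p q : W} (h : q ≠ p) (Y Z : Set X) :
    updW (updW V p Y) q Z = updW (updW V q Z) p Y := by
  funext w
  simp only [updW]
  split_ifs with h1 h2 <;> first | rfl | exact absurd (h1.symm.trans h2) h

theorem updW_updW {W X : Type} (V : W → Set X) (p : W) (Y Z : Set X) :
    updW (updW V p Y) p Z = updW V p Z := by
  funext w
  simp only [updW]
  split_ifs <;> rfl

theorem PosIn.sem_mono {S : Type} {σ : S → T.obj S} {p : ℕ} {φ : MuForm F} (hφ : φ.PosIn p)
    (V : ℕ → Set S) {Y Z : Set S} (h : Y ⊆ Z) :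
    φ.sem σ (updW V p Y) ⊆ φ.sem σ (updW V p Z) := by
  induction φ generalizing V with
  | var q =>
    by_cases hq : q = p
    · subst hq
      simpa only [sem, updW_self] using h
    · simp only [sem, updW_ne _ _ hq, Set.Subset.rfl]
  | nvar q => simp only [sem, updW_ne _ _ (show q ≠ p from hφ), Set.Subset.rfl]
  | bot => exact Set.Subset.rfl
  | top => exact Set.Subset.rfl
  | lift i arg ih => exact fun s hs => F.mono i _ _ _ (fun k => ih k (hφ k) V) hs
  | or φ ψ ih ih' => exact Set.union_subset_union (ih hφ.1 V) (ih' hφ.2 V)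
  | and φ ψ ih ih' => exact Set.inter_subset_inter (ih hφ.1 V) (ih' hφ.2 V)
  | mu q φ ih =>
    rw [sem_mu, sem_mu]
    refine fp_mono _ fun X => ?_
    by_cases hq : q = p
    · subst hq
      simp only [updW_updW, Set.Subset.rfl]
    · simpa only [updW_comm V hq] using ih (hφ.resolve_left hq) _
  | nu q φ ih =>
    rw [sem_nu, sem_nu]
    refine fp_mono _ fun X => ?_
    by_cases hq : q = p
    · subst hq
      simp only [updW_updW, Set.Subset.rfl]
    · simpa only [updW_comm V hq] using ih (hφ.resolve_left hq) _

theorem preimage_updW {W X Y : Type} (f : X → Y) (V : W → Set Y) (p : W) (Z : Set Y) :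
    (fun q => f ⁻¹' updW V p Z q) = updW (fun q => f ⁻¹' V q) p (f ⁻¹' Z) := by
  funext q
  simp only [updW]
  split_ifs <;> rfl

/-- Truth sets of well-formed formulas are preserved by coalgebra morphisms. -/
theorem WF.sem_preimage {S S' : Type} {σ : S → T.obj S} {σ' : S' → T.obj S'} {f : S → S'}
    (hf : ∀ x, σ' (f x) = T.map f (σ x)) {φ : MuForm F} (hφ : φ.WF) (V : ℕ → Set S') :
    f ⁻¹' φ.sem σ' V = φ.sem σ fun p => f ⁻¹' V p := by
  induction φ generalizing V with
  | var q => rfl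
  | nvar q => rfl
  | bot => rfl
  | top => rfl
  | lift i arg ih =>
    ext x
    change σ' (f x) ∈ (F.lf i).app S' _ ↔ σ x ∈ (F.lf i).app S _
    simp only [← ih _ (hφ _), (F.lf i).natural, hf]
    rfl
  | or φ ψ ih ih' => simp only [sem, Set.preimage_union, ih hφ.1, ih' hφ.2]
  | and φ ψ ih ih' => simp only [sem, Set.preimage_inter, ih hφ.1, ih' hφ.2]
  | mu q φ ih =>
    rw [sem_mu, sem_mu]
    refine fp_preimage f _ (fun _ _ h => hφ.1.sem_mono _ h) (fun _ _ h => hφ.1.sem_mono _ h)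
      fun Z => ?_
    rw [ih hφ.2, preimage_updW]
  | nu q φ ih =>
    rw [sem_nu, sem_nu]
    refine fp_preimage f _ (fun _ _ h => hφ.1.sem_mono _ h) (fun _ _ h => hφ.1.sem_mono _ h)
      fun Z => ?_
    rw [ih hφ.2, preimage_updW]

theorem WF.sem_hom {M N : TModel T} {f : M.S → N.S} (hf : IsHom M N f) {φ : MuForm F}
    (hφ : φ.WF) (x : M.S) : x ∈ φ.sem M.σ M.V ↔ f x ∈ φ.sem N.σ N.V := by
  have hV : M.V = fun p => f ⁻¹' N.V p := funext fun p => Set.ext (hf.1 p)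
  rw [hV, ← hφ.sem_preimage hf.2]
  rfl

theorem WF.sem_behEq {φ : MuForm F} (hφ : φ.WF) {M M' : TModel T} {s : M.S} {s' : M'.S}
    (h : BehEq M s M' s') : s ∈ φ.sem M.σ M.V ↔ s' ∈ φ.sem M'.σ M'.V := by
  obtain ⟨N, f, g, hf, hg, hs⟩ := h
  rw [hφ.sem_hom hf, hφ.sem_hom hg, hs]

end MuForm

/-! ### Unravelling along a uniform construction -/

namespace UniformConstruction

variable {T : SetFunctor} (U : UniformConstruction T) {S : Type} (σ : S → T.obj S) (u : S)

/-- The endpoint of a sequence of moves. -/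
def target : List (Σ s : S, U.star S (σ s)) → S
  | [] => u
  | y :: _ => U.h S (σ y.1) y.2

/-- Sequences of consecutive moves from `u`, the latest move first. -/
def IsPath : List (Σ s : S, U.star S (σ s)) → Prop
  | [] => True
  | y :: l => y.1 = U.target σ u l ∧ IsPath l

/-- The unravelling of a coalgebra. -/
def unravel : Tr T where
  N := {l // U.IsPath σ u l}
  root := ⟨[], trivial⟩
  Ch l := U.star S (σ (U.target σ u l.1))
  α l := U.el S (σ (U.target σ u l.1))
  child l x := ⟨⟨U.target σ u l.1, x⟩ :: l.1, rfl, l.2⟩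
  depth l := l.1.length
  depth_root := rfl
  depth_child _ _ := rfl
  cases := by
    rintro ⟨_ | ⟨⟨s, x⟩, l⟩, h⟩
    · exact .inl rfl
    · obtain rfl : s = _ := h.1
      exact .inr ⟨⟨l, h.2⟩, x, rfl⟩
  inj := by
    rintro ⟨l, hl⟩ ⟨l', hl'⟩ x x' h
    obtain ⟨h1, rfl⟩ := List.cons.inj (congrArg Subtype.val h)
    obtain rfl := eq_of_heq (Sigma.mk.inj h1).2
    rfl

/-- The projection of the unravelling. -/
def proj (l : (U.unravel σ u).N) : S := U.target σ u l.1

theorem proj_σ (l : (U.unravel σ u).N) :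
    σ (U.proj σ u l) = T.map (U.proj σ u) ((U.unravel σ u).σ l) := by
  rw [Tr.σ, ← T.map_comp]
  exact (U.spec S (σ (U.proj σ u l))).symm

theorem behEq_unravel (M : TModel T) (u : M.S) :
    BehEq M u ⟨(U.unravel M.σ u).N, (U.unravel M.σ u).σ, fun p => U.proj M.σ u ⁻¹' M.V p⟩
      (U.unravel M.σ u).root :=
  ⟨M, id, U.proj M.σ u, ⟨fun _ _ => Iff.rfl, fun _ => (T.map_id _).symm⟩,
    ⟨fun _ _ => Iff.rfl, U.proj_σ M.σ u⟩, rfl⟩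

end UniformConstruction

/-! ### From automata to the μ-calculus -/

section ToMu

variable {T : SetFunctor} {F : LiftingFamily T} {A : Type}

/-- Substitution of formulas into a lattice term. -/
def LatTerm.toMu (e : A → MuForm F) : LatTerm A → MuForm F
  | .var a => e a
  | .and s t => .and (s.toMu e) (t.toMu e)
  | .or s t => .or (s.toMu e) (t.toMu e)

theorem LatTerm.sem_toMu {S : Type} (σ : S → T.obj S) (V : ℕ → Set S) (e : A → MuForm F)
    (s : LatTerm A) : (s.toMu e).sem σ V = s.sem fun a => (e a).sem σ V := by
  induction s with
  | var a => rfl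
  | and s t ih ih' => simp only [toMu, MuForm.sem, LatTerm.sem, ih, ih']
  | or s t ih ih' => simp only [toMu, MuForm.sem, LatTerm.sem, ih, ih']

/-- Substitution of formulas into a modal one-step formula. -/
def ML1.toMu (e : A → MuForm F) : ML1 F A → MuForm F
  | .bot => .bot
  | .top => .top
  | .lift i ψ => .lift i fun k => (ψ k).toMu e
  | .or φ ψ => .or (φ.toMu e) (ψ.toMu e)
  | .and φ ψ => .and (φ.toMu e) (ψ.toMu e)

theorem ML1.mem_sem_toMu {S : Type} (σ : S → T.obj S) (V : ℕ → Set S) (e : A → MuForm F)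
    (φ : ML1 F A) (s : S) :
    s ∈ (φ.toMu e).sem σ V ↔ φ.sat S (σ s) fun a => (e a).sem σ V := by
  induction φ with
  | bot => rfl
  | top => rfl
  | lift i ψ =>
    change σ s ∈ (F.lf i).app S _ ↔ σ s ∈ (F.lf i).app S _
    simp only [LatTerm.sem_toMu]
  | or φ ψ ih ih' => exact or_congr ih ih'
  | and φ ψ ih ih' => exact and_congr ih ih'

/-- Well-formedness together with positivity in all variables from `b` on. -/
def MuForm.Good (b : ℕ) (φ : MuForm F) : Prop := φ.WF ∧ ∀ p, b ≤ p → φ.PosIn p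

theorem LatTerm.good_toMu {b : ℕ} {e : A → MuForm F} (he : ∀ a, (e a).Good b) (s : LatTerm A) :
    (s.toMu e).Good b := by
  induction s with
  | var a => exact he a
  | and s t ih ih' => exact ⟨⟨ih.1, ih'.1⟩, fun p hp => ⟨ih.2 p hp, ih'.2 p hp⟩⟩
  | or s t ih ih' => exact ⟨⟨ih.1, ih'.1⟩, fun p hp => ⟨ih.2 p hp, ih'.2 p hp⟩⟩

theorem ML1.good_toMu {b : ℕ} {e : A → MuForm F} (he : ∀ a, (e a).Good b) (φ : ML1 F A) :
    (φ.toMu e).Good b := by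
  induction φ with
  | bot => exact ⟨trivial, fun _ _ => trivial⟩
  | top => exact ⟨trivial, fun _ _ => trivial⟩
  | lift i ψ =>
    exact ⟨fun k => ((ψ k).good_toMu he).1, fun p hp k => ((ψ k).good_toMu he).2 p hp⟩
  | or φ ψ ih ih' => exact ⟨⟨ih.1, ih'.1⟩, fun p hp => ⟨ih.2 p hp, ih'.2 p hp⟩⟩
  | and φ ψ ih ih' => exact ⟨⟨ih.1, ih'.1⟩, fun p hp => ⟨ih.2 p hp, ih'.2 p hp⟩⟩

/-- Case distinction on the variables below `n`. -/
def MuForm.split (f : Set ℕ → MuForm F) : ℕ → Set ℕ → MuForm F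
  | 0, c => f c
  | n + 1, c => .or (.and (.var n) (split f n (insert n c))) (.and (.nvar n) (split f n c))

theorem MuForm.mem_sem_split {S : Type} (σ : S → T.obj S) (V : ℕ → Set S) (f : Set ℕ → MuForm F)
    (n : ℕ) (c : Set ℕ) (s : S) :
    s ∈ (split f n c).sem σ V ↔ s ∈ (f (c ∪ {p | p < n ∧ s ∈ V p})).sem σ V := by
  induction n generalizing c with
  | zero => simp [split]
  | succ n ih =>
    have key : ∀ c', (c' ∪ {p | p < n ∧ s ∈ V p} = c ∪ {p | p < n + 1 ∧ s ∈ V p}) →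
        (s ∈ (split f n c').sem σ V ↔
          s ∈ (f (c ∪ {p | p < n + 1 ∧ s ∈ V p})).sem σ V) := fun c' h => by rw [ih, h]
    change s ∈ V n ∧ _ ∨ s ∉ V n ∧ _ ↔ _
    by_cases hs : s ∈ V n
    · rw [key (insert n c)]
      · simp [hs]
      · ext p
        simp only [Set.mem_union, Set.mem_insert_iff, Set.mem_ofPred_eq, Nat.lt_succ_iff_lt_or_eq]
        by_cases hp : p = n
        · subst hp
          simp [hs]
        · simp [hp]
    · rw [key c]
      · simp [hs]
      · ext p
        simp only [Set.mem_union, Set.mem_ofPred_eq, Nat.lt_succ_iff_lt_or_eq]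
        by_cases hp : p = n
        · subst hp
          simp [hs]
        · simp [hp]

theorem MuForm.good_split {b : ℕ} {f : Set ℕ → MuForm F} (hf : ∀ c, (f c).Good b) {n : ℕ}
    (hn : n ≤ b) (c : Set ℕ) : (split f n c).Good b := by
  induction n generalizing c with
  | zero => exact hf c
  | succ n ih =>
    have h1 := ih (by omega) c
    have h2 := ih (by omega) (insert n c)
    exact ⟨⟨⟨trivial, h2.1⟩, trivial, h1.1⟩, fun p hp =>
      ⟨⟨trivial, h2.2 p hp⟩, show n ≠ p by omega, h1.2 p hp⟩⟩

/-- The fixpoint formula of the given kind. -/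
noncomputable def MuForm.fix (ν : Prop) (p : ℕ) (φ : MuForm F) : MuForm F :=
  if ν then .nu p φ else .mu p φ

theorem MuForm.sem_fix {S : Type} (σ : S → T.obj S) (V : ℕ → Set S) (ν : Prop) (p : ℕ)
    (φ : MuForm F) : (fix ν p φ).sem σ V = fp ν fun Z => φ.sem σ (updW V p Z) := by
  by_cases h : ν
  · rw [fix, if_pos h, sem_nu]
    exact fp_congr (iff_of_true trivial h) fun _ => rfl
  · rw [fix, if_neg h, sem_mu]
    exact fp_congr (iff_of_false id h) fun _ => rfl

theorem MuForm.Good.fix {b : ℕ} {φ : MuForm F} (hφ : φ.Good b) (ν : Prop) {p : ℕ} (hp : b ≤ p) :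
    (MuForm.fix ν p φ).Good b := by
  by_cases h : ν
  · rw [MuForm.fix, if_pos h]
    exact ⟨⟨hφ.2 p hp, hφ.1⟩, fun q hq => .inr (hφ.2 q hq)⟩
  · rw [MuForm.fix, if_neg h]
    exact ⟨⟨hφ.2 p hp, hφ.1⟩, fun q hq => .inr (hφ.2 q hq)⟩

/-- The syntactic counterpart of `sol`, where `b + k` is the fixpoint variable of `en k`. -/
noncomputable def muSol {Q : Type} (b : ℕ) (ν : ℕ → Prop) (en : ℕ → Q)
    (Φ : (Q → MuForm F) → Q → MuForm F) : ℕ → (Q → MuForm F) → Q → MuForm F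
  | 0, e => e
  | k + 1, e => muSol b ν en Φ k (Function.update e (en k)
      (.fix (ν k) (b + k) (Φ (muSol b ν en Φ k (Function.update e (en k) (.var (b + k)))) (en k))))

theorem good_muSol {Q : Type} {b : ℕ} {ν : ℕ → Prop} {en : ℕ → Q}
    {Φ : (Q → MuForm F) → Q → MuForm F}
    (hΦ : ∀ e, (∀ q, (e q).Good b) → ∀ q, (Φ e q).Good b) (k : ℕ) {e : Q → MuForm F}
    (he : ∀ q, (e q).Good b) (q : Q) : (muSol b ν en Φ k e q).Good b := by
  have hupd : ∀ {e : Q → MuForm F} {q₀ y}, (∀ q, (e q).Good b) → y.Good b →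
      ∀ q, (Function.update e q₀ y q).Good b := by
    intro e q₀ y he hy q
    by_cases hq : q = q₀
    · subst hq
      simpa using hy
    · simpa [hq] using he q
  induction k generalizing e q with
  | zero => exact he q
  | succ k ih =>
    refine ih (hupd he (.fix (hΦ _ (ih (hupd he ?_)) _) _ (by omega))) q
    exact ⟨trivial, fun _ _ => trivial⟩

theorem sem_update {Q S : Type} (σ : S → T.obj S) (V : ℕ → Set S) (e : Q → MuForm F) (q : Q)
    (y : MuForm F) : (fun q' => (Function.update e q y q').sem σ V) =
      updW (fun q' => (e q').sem σ V) q (y.sem σ V) := by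
  funext q'
  by_cases hq : q' = q
  · subst hq
    simp [updW_self]
  · simp [updW_ne _ _ hq, hq]

theorem sem_muSol {Q S : Type} {σ : S → T.obj S} {b : ℕ} {ν : ℕ → Prop} {en : ℕ → Q}
    {Φ : (Q → MuForm F) → Q → MuForm F} {Ψ : (ℕ → Set S) → (Q → Set S) → Q → Set S}
    (h : ∀ e V q, (Φ e q).sem σ V = Ψ V (fun q' => (e q').sem σ V) q)
    (hΨ : ∀ V p Z, b ≤ p → Ψ (updW V p Z) = Ψ V) (k : ℕ) (e : Q → MuForm F)
    (he : ∀ q j V Z, j < k → (e q).sem σ (updW V (b + j) Z) = (e q).sem σ V)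
    (V : ℕ → Set S) :
    (fun q => (muSol b ν en Φ k e q).sem σ V) =
      sol ν en (Ψ V) k fun q => (e q).sem σ V := by
  induction k generalizing e V with
  | zero => rfl
  | succ k ih =>
    have h1 : ∀ V, (MuForm.fix (ν k) (b + k)
        (Φ (muSol b ν en Φ k (Function.update e (en k) (.var (b + k)))) (en k))).sem σ V =
        fp (ν k) fun x => Ψ V (sol ν en (Ψ V) k
          (updW (fun q => (e q).sem σ V) (en k) x)) (en k) := by
      intro V
      rw [MuForm.sem_fix]
      refine fp_congr Iff.rfl fun Z => ?_
      rw [h, ih, hΨ V _ _ (by omega), sem_update]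
      · simp only [he _ k _ _ (Nat.lt_succ_self k), MuForm.sem, updW_self]
      · intro q j V Z hj
        by_cases hq : q = en k
        · subst hq
          have : b + k ≠ b + j := by omega
          simp [MuForm.sem, updW_ne _ _ this]
        · simpa [hq] using he q j V Z (by omega)
    rw [muSol, ih, sem_update, h1, sol]
    intro q j V Z hj
    by_cases hq : q = en k
    · subst hq
      simp only [Function.update_self, h1, hΨ V _ _ (Nat.le_add_right b j)]
      simp only [he _ j _ _ (Nat.lt_succ_of_lt hj)]
    · simpa [hq] using he q j V Z (by omega)

/-- Automata are equivalent to formulas of the μ-calculus on suitable unravellings. -/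
theorem Aut.exists_muForm (hec : ExpressivelyComplete F) (hut : AdmitsUniformTranslations F)
    (A : Aut F) : ∃ (U : UniformConstruction T) (ψ : MuForm F), ψ.WF ∧
      ∀ (M : TModel T) (u : M.S), u ∈ ψ.sem M.σ M.V ↔
        A.Acc (U.unravel M.σ u) fun p => U.proj M.σ u ⁻¹' M.V p := by
  choose ξ hξ hsat using A.dfn
  let r : Set ℕ → Set ℕ := fun c => {p | p < A.bd ∧ p ∈ c}
  have hfin : (Set.range fun x : A.Q × Set ℕ => (ξ x.1 (r x.2)).qd).Finite := by
    have h1 : (Set.range r).Finite :=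
      (Set.finite_Iio A.bd).finite_subsets.subset (by
        rintro _ ⟨c, rfl⟩ p hp
        exact hp.1)
    refine ((Set.finite_univ.prod h1).image fun x : A.Q × Set ℕ => (ξ x.1 x.2).qd).subset ?_
    rintro _ ⟨⟨q, c⟩, rfl⟩
    exact ⟨(q, r c), ⟨trivial, c, rfl⟩, rfl⟩
  obtain ⟨k, hk⟩ := hfin.bddAbove
  obtain ⟨U, hU⟩ := hut k
  have hmono : ∀ q c, MonotoneSent (ξ q c) := fun q c X α V V' h hV =>
    (hsat q c X α V').2 (A.mono h ((hsat q c X α V).1 hV))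
  choose g hg hgm hgs using fun q c =>
    hU A.Q (ξ q (r c)) (hξ _ _) (hmono _ _) (hk ⟨(q, c), rfl⟩)
  choose θ hθ using fun q c => hec A.Q A.fin (g q c) (hg q c) (hgm q c)
  have hr : ∀ q c, A.Δ q (r c) = A.Δ q c := fun q c => A.supp fun p hp => by simp [r, hp]
  have : Nonempty A.Q := ⟨A.init⟩
  obtain ⟨E⟩ := exists_enum A.Q A.Ω
  let ν : ℕ → Prop := fun k => Even (A.Ω (E.en k))
  let Φ : (A.Q → MuForm F) → A.Q → MuForm F := fun e q =>
    .split (fun c => (θ q c).toMu e) A.bd ∅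
  refine ⟨U, muSol A.bd ν E.en Φ E.n (fun _ => MuForm.bot) A.init,
    (good_muSol (fun e he q => MuForm.good_split (fun c => ML1.good_toMu he _) le_rfl _) _
      (e := fun _ => MuForm.bot) (fun _ => ⟨trivial, fun _ _ => trivial⟩) _).1, fun M u => ?_⟩
  let Ψ : (ℕ → Set M.S) → (A.Q → Set M.S) → A.Q → Set M.S := fun V e q =>
    {s | M.σ s ∈ (g q {p | p < A.bd ∧ s ∈ V p}).app M.S e}
  have hΨ : ∀ V, OpMono (Ψ V) := fun V e e' h q s hs => hgm _ _ _ _ _ h hs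
  have hsem := congrFun (sem_muSol (σ := M.σ) (b := A.bd) (ν := ν) (en := E.en) (Φ := Φ) (Ψ := Ψ)
    (fun e V q => by
      ext s
      rw [MuForm.mem_sem_split, ML1.mem_sem_toMu, hθ, Set.empty_union]
      rfl)
    (fun V p Z hp => by
      have : ∀ s, {p' | p' < A.bd ∧ s ∈ updW V p Z p'} = {p' | p' < A.bd ∧ s ∈ V p'} := by
        intro s
        ext p'
        refine and_congr_right fun h => ?_
        rw [updW_ne _ _ (by omega)]
      simp only [Ψ, this])
    E.n (fun _ => .bot) (fun _ _ _ _ _ => rfl) M.V) A.init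
  have hpre := congrFun (sol_preimage (U.proj M.σ u) ν E.en (hΨ M.V)
    (A.step_mono (U.unravel M.σ u) fun p => U.proj M.σ u ⁻¹' M.V p) (fun e q => by
      ext t
      change M.σ (U.proj M.σ u t) ∈ (g q _).app M.S e ↔ _
      rw [hgs, hsat, hr]
      exact iff_of_eq (congrArg (fun Δ : OS T A.Q => Δ _ _ _)
        (hr q {p | U.proj M.σ u t ∈ M.V p}))) E.n fun _ => ∅) A.init
  rw [Aut.Acc, wins_iff_sol E (A.step_mono _ _) (fun _ => U.proj M.σ u ⁻¹' ∅), ← hpre]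
  exact Set.ext_iff.1 hsem u

end ToMu

/-- **Characterization Theorem.** If `Λ` is an expressively complete set
of monotone predicate liftings for `T` and `SO¹_Λ` admits uniform translations, then
`μML_Λ` is the bisimulation-invariant fragment of `MSO_Λ`: an `MSO_Λ`-formula is
invariant for behavioral equivalence iff it is equivalent, over all pointed
`T`-models, to a `μML_Λ`-formula. -/
theorem characterization_theorem (T : SetFunctor) (F : LiftingFamily T)
    (hec : ExpressivelyComplete F) (hut : AdmitsUniformTranslations F)
    (φ : MSOForm F) :
    BisimInv φ ↔
      ∃ ψ : MuForm F, ψ.WF ∧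
        ∀ (M : TModel T) (u : M.S), φ.sat M.σ M.V u ↔ u ∈ ψ.sem M.σ M.V := by
  obtain ⟨A, hA⟩ := φ.exists_aut
  obtain ⟨U, ψ, hψ, hsem⟩ := A.exists_muForm hec hut
  constructor
  · exact fun h => ⟨ψ, hψ, fun M u => by
      rw [hsem, ← hA, h _ _ _ _ (U.behEq_unravel M u)]⟩
  · rintro ⟨ψ, hψ, h⟩ M s M' s' hs
    rw [h, h, hψ.sem_behEq hs]
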